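/- (Malgrange preparation theorem, as used in the paper.) Let F be a real-valued C∞ function on a neighborhood of the origin in ℝ² such that y ↦ F(0,y) is not flat at 0, so that F(0,y) = c yⁿ + o(yⁿ) as y → 0 for some integer n ≥ 0 and c ≠ 0. Then on a possibly smaller neighborhood of the origin there is a factorization F(x,y) = U(x,y) P(x,y), where: (1) U is a real-valued C∞ function with U(0,0) ≠ 0; (2) P(x,y) = yⁿ + c_{n−1}(x) y^{n−1} + … + c_0(x), where each c_i is a real-valued C∞ function of x near 0 with c_i(0) = 0. -/

import Mathlib

open Set Asymptotics Filter
open scoped ContDiff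

lemma mg_smoothTransition_temperate : Function.HasTemperateGrowth Real.smoothTransition := by
  have hc : ContDiff ℝ ∞ Real.smoothTransition := Real.smoothTransition.contDiff
  refine Function.HasTemperateGrowth.of_fderiv ?_ (hc.differentiable (by simp)) (k := 0) (C := 1) ?_
  · apply HasCompactSupport.hasTemperateGrowth
    · apply HasCompactSupport.of_support_subset_isCompact (isCompact_Icc (a := (0:ℝ)) (b := 1))
      intro x hx
      by_contra hx'
      apply hx
      rw [mem_Icc, not_and_or, not_le, not_le] at hx'
      rcases hx' with h | h
      · have : Real.smoothTransition =ᶠ[nhds x] fun _ => 0 := by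
          filter_upwards [Iio_mem_nhds h] with y hy
          exact Real.smoothTransition.zero_of_nonpos (le_of_lt hy)
        rw [this.fderiv_eq]; simp
      · have : Real.smoothTransition =ᶠ[nhds x] fun _ => 1 := by
          filter_upwards [Ioi_mem_nhds h] with y hy
          exact Real.smoothTransition.one_of_one_le (le_of_lt hy)
        rw [this.fderiv_eq]; simp
    · exact hc.fderiv_right (by simp)
  · intro x
    simp only [pow_zero, mul_one, Real.norm_eq_abs]
    rw [abs_of_nonneg (Real.smoothTransition.nonneg x)]
    exact Real.smoothTransition.le_one x

lemma mg_exists_phi : ∃ φ : ℝ → ℝ, Function.HasTemperateGrowth φ ∧ ∀ r, 1 ≤ r → φ r = r⁻¹ := by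
  let f : ℝ → ℝ := fun r => 1 + Real.smoothTransition (2 * r - 1) * (r - 1)
  have hS := mg_smoothTransition_temperate
  have hf : Function.HasTemperateGrowth f := by
    have h2 : Function.HasTemperateGrowth (fun r : ℝ => Real.smoothTransition (2 * r - 1)) :=
      hS.comp (f := fun r : ℝ => 2 * r - 1) (by fun_prop)
    fun_prop
  refine ⟨(fun r => r⁻¹) ∘ f, ?_, ?_⟩
  · refine Function.HasTemperateGrowth.comp' (t := Ioi (1/4 : ℝ)) ?_ isOpen_Ioi.uniqueDiffOn ?_ ?_ hf
    · rintro _ ⟨r, rfl⟩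
      simp only [f, mem_Ioi]
      rcases le_total r (1/2) with h | h
      · rw [Real.smoothTransition.zero_of_nonpos (by linarith)]; norm_num
      · have h0 := Real.smoothTransition.nonneg (2 * r - 1)
        have h1 := Real.smoothTransition.le_one (2 * r - 1)
        nlinarith
    · apply contDiffOn_id.inv
      intro x hx
      simp only [mem_Ioi] at hx
      simp only [id]; linarith
    · intro N
      refine ⟨0, (N.factorial : ℝ) * 4 ^ (N + 1), by positivity, ?_⟩
      intro n hn x hx
      have hx' : (1/4 : ℝ) < x := hx
      rw [norm_iteratedFDerivWithin_eq_norm_iteratedDerivWithin,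
        iteratedDerivWithin_of_isOpen isOpen_Ioi hx, iteratedDeriv_eq_iterate, iter_deriv_inv]
      simp only [pow_zero, mul_one, norm_mul, norm_pow, norm_neg, norm_one, one_pow, one_mul]
      have hpos : 0 < x := by linarith
      have h1 : ‖x ^ (-1 - (n:ℤ))‖ = (x⁻¹) ^ (n + 1) := by
        rw [norm_zpow, Real.norm_of_nonneg hpos.le, show (-1 - (n:ℤ)) = -((n+1 : ℕ) : ℤ) by push_cast; ring,
          zpow_neg, zpow_natCast, inv_pow]
      rw [h1]
      have h2 : x⁻¹ ≤ 4 := by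
        rw [inv_le_comm₀ hpos (by norm_num)]; linarith
      have h3 : (x⁻¹) ^ (n + 1) ≤ 4 ^ (N + 1) :=
        (pow_le_pow_left₀ (by positivity) h2 _).trans (pow_le_pow_right₀ (by norm_num) (by omega))
      have h4 : ‖(n.factorial : ℝ)‖ ≤ N.factorial := by
        rw [Real.norm_natCast]; exact_mod_cast Nat.factorial_le hn
      gcongr
  · intro r hr
    simp only [Function.comp, f]
    rw [Real.smoothTransition.one_of_one_le (by linarith)]
    congr 1; ring

lemma mg_exists_iota : ∃ κ : ℂ → ℂ, Function.HasTemperateGrowth κ ∧ ∀ z, 1 ≤ ‖z‖ → κ z = z⁻¹ := by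
  obtain ⟨φ, hφ, h1⟩ := mg_exists_phi
  have hconj : Function.HasTemperateGrowth (fun z : ℂ => (starRingEnd ℂ) z) :=
    (Complex.conjCLE : ℂ ≃L[ℝ] ℂ).hasTemperateGrowth
  have hn : Function.HasTemperateGrowth (fun z : ℂ => ‖z‖ ^ 2) :=
    Function.hasTemperateGrowth_norm_sq ℂ
  have hc : Function.HasTemperateGrowth (fun z : ℂ => φ (‖z‖ ^ 2)) := hφ.comp hn
  have hc' : Function.HasTemperateGrowth (fun z : ℂ => ((φ (‖z‖ ^ 2) : ℝ) : ℂ)) :=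
    (Complex.ofRealCLM.hasTemperateGrowth).comp hc
  refine ⟨fun z => (starRingEnd ℂ) z * (φ (‖z‖ ^ 2) : ℝ), hconj.mul hc', ?_⟩
  intro z hz
  show (starRingEnd ℂ) z * (φ (‖z‖ ^ 2) : ℝ) = z⁻¹
  rw [h1 _ (by nlinarith), Complex.inv_def, ← Complex.normSq_eq_norm_sq]

lemma mg_exists_chi : ∃ χ : ℝ → ℝ, Function.HasTemperateGrowth χ ∧ (∀ t, χ t ≠ 0 → |t| ≤ 2) ∧
    ∀ (M : ℕ) (t : ℝ), |t| ≤ M → ∑ k ∈ Finset.range (2 * M + 3), χ (t - ((k : ℝ) - M - 1)) = 1 := by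
  have hS := mg_smoothTransition_temperate
  refine ⟨fun t => Real.smoothTransition t - Real.smoothTransition (t - 1), ?_, ?_, ?_⟩
  · have h2 : Function.HasTemperateGrowth (fun r : ℝ => Real.smoothTransition (r - 1)) :=
      hS.comp (f := fun r : ℝ => r - 1) (by fun_prop)
    fun_prop
  · intro t ht
    by_contra h
    apply ht
    show Real.smoothTransition t - Real.smoothTransition (t - 1) = 0
    rw [not_le, lt_abs] at h
    rcases h with h | h
    · rw [Real.smoothTransition.one_of_one_le (by linarith), Real.smoothTransition.one_of_one_le (by linarith)]
      simp
    · rw [Real.smoothTransition.zero_of_nonpos (by linarith), Real.smoothTransition.zero_of_nonpos (by linarith)]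
      simp
  · intro M t ht
    have := Finset.sum_range_sub' (fun k : ℕ => Real.smoothTransition (t - ((k : ℝ) - M - 1))) (2 * M + 3)
    rw [abs_le] at ht
    rw [Real.smoothTransition.one_of_one_le (by push_cast; linarith),
      Real.smoothTransition.zero_of_nonpos (by push_cast; linarith)] at this
    rw [sub_zero] at this
    refine Eq.trans (Finset.sum_congr rfl fun k _ => ?_) this
    push_cast
    congr 2
    ring

lemma mg_exists_bump : ∃ β : ℝ → ℝ, Function.HasTemperateGrowth β ∧ (∀ t, β t ≠ 0 → |t| ≤ 1) ∧
    ∀ t, |t| ≤ 1 / 2 → β t = 1 := by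
  let b : ContDiffBump (0 : ℝ) := ⟨1/2, 1, by norm_num, by norm_num⟩
  refine ⟨b, b.hasCompactSupport.hasTemperateGrowth b.contDiff, ?_, ?_⟩
  · intro t ht
    have : t ∈ Function.support b := ht
    rw [b.support_eq] at this
    have h2 : |t| < 1 := by simpa [b] using this
    exact h2.le
  · intro t ht
    apply b.one_of_mem_closedBall
    simpa [b] using ht

lemma mg_hasFDerivAt_integral {E G : Type} [NormedAddCommGroup E] [NormedSpace ℝ E]
    [FiniteDimensional ℝ E] [NormedAddCommGroup G] [NormedSpace ℝ G] [CompleteSpace G]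
    (a b : ℝ) (g : E × ℝ → G) (hg : ContDiff ℝ ∞ g) (v : E) :
    HasFDerivAt (fun v => ∫ θ in a..b, g (v, θ))
      (∫ θ in a..b, fderiv ℝ (fun v => g (v, θ)) v) v := by
  have hfd : ∀ v θ, fderiv ℝ (fun v => g (v, θ)) v =
      (fderiv ℝ g (v, θ)).comp (ContinuousLinearMap.inl ℝ E ℝ) := by
    intro v θ
    have h1 : HasFDerivAt g (fderiv ℝ g (v, θ)) (v, θ) :=
      (hg.differentiable (by simp) _).hasFDerivAt
    exact (h1.comp v (hasFDerivAt_prodMk_left v θ)).fderiv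
  have hcont : Continuous (fun q : E × ℝ => fderiv ℝ (fun v => g (v, q.2)) q.1) := by
    simp_rw [hfd]
    have := hg.continuous_fderiv (by simp)
    fun_prop
  have hK : IsCompact (Metric.closedBall v 1 ×ˢ uIcc a b) :=
    (isCompact_closedBall v 1).prod isCompact_uIcc
  obtain ⟨C, hC⟩ := hK.exists_bound_of_continuousOn hcont.continuousOn
  refine intervalIntegral.hasFDerivAt_integral_of_dominated_of_fderiv_le (μ := MeasureTheory.volume)
    (F := fun v θ => g (v, θ)) (F' := fun v θ => fderiv ℝ (fun v => g (v, θ)) v)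
    (s := Metric.closedBall v 1) (bound := fun _ => C)
    (Metric.closedBall_mem_nhds v one_pos) ?_ ?_ ?_ ?_ ?_ ?_
  · refine Eventually.of_forall fun x => ?_
    have : Continuous fun θ => g (x, θ) := hg.continuous.comp (by fun_prop)
    exact this.aestronglyMeasurable
  · have : Continuous fun θ => g (v, θ) := hg.continuous.comp (by fun_prop)
    exact this.intervalIntegrable _ _
  · have : Continuous fun θ => fderiv ℝ (fun v => g (v, θ)) v :=
      hcont.comp (by fun_prop : Continuous fun θ : ℝ => (v, θ))
    exact this.aestronglyMeasurable
  · refine Eventually.of_forall fun θ hθ x hx => ?_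
    exact hC (x, θ) ⟨hx, uIoc_subset_uIcc hθ⟩
  · exact intervalIntegrable_const
  · refine Eventually.of_forall fun θ hθ x hx => ?_
    have : DifferentiableAt ℝ (fun v => g (v, θ)) x := by
      have h1 := (hg.differentiable (by simp) (x, θ)).hasFDerivAt
      exact (h1.comp x (hasFDerivAt_prodMk_left x θ)).differentiableAt
    exact this.hasFDerivAt

lemma mg_contDiff_slice {E G : Type} [NormedAddCommGroup E] [NormedSpace ℝ E]
    [NormedAddCommGroup G] [NormedSpace ℝ G]
    (g : E × ℝ → G) (hg : ContDiff ℝ ∞ g) :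
    ContDiff ℝ ∞ (fun q : E × ℝ => fderiv ℝ (fun v => g (v, q.2)) q.1) := by
  have hfd : ∀ v θ, fderiv ℝ (fun v => g (v, θ)) v =
      (fderiv ℝ g (v, θ)).comp (ContinuousLinearMap.inl ℝ E ℝ) := by
    intro v θ
    have h1 : HasFDerivAt g (fderiv ℝ g (v, θ)) (v, θ) :=
      (hg.differentiable (by simp) _).hasFDerivAt
    exact (h1.comp v (hasFDerivAt_prodMk_left v θ)).fderiv
  simp_rw [hfd]
  have : ContDiff ℝ ∞ (fderiv ℝ g) := hg.fderiv_right (by simp)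
  exact this.clm_comp contDiff_const

lemma mg_contDiff_integral {E : Type} [NormedAddCommGroup E] [NormedSpace ℝ E]
    [FiniteDimensional ℝ E] (a b : ℝ) (k : ℕ) :
    ∀ {G : Type} [NormedAddCommGroup G] [NormedSpace ℝ G] [CompleteSpace G]
    (g : E × ℝ → G) (_ : ContDiff ℝ ∞ g), ContDiff ℝ k (fun v => ∫ θ in a..b, g (v, θ)) := by
  induction k with
  | zero =>
    intro G _ _ _ g hg
    rw [Nat.cast_zero, contDiff_zero]
    exact continuous_iff_continuousAt.2 fun v => (mg_hasFDerivAt_integral a b g hg v).continuousAt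
  | succ k ih =>
    intro G _ _ _ g hg
    have hd := mg_hasFDerivAt_integral a b g hg
    rw [Nat.cast_succ, contDiff_succ_iff_fderiv]
    refine ⟨fun v => (hd v).differentiableAt, by simp, ?_⟩
    rw [show fderiv ℝ (fun v => ∫ θ in a..b, g (v, θ)) =
      fun v => ∫ θ in a..b, fderiv ℝ (fun v => g (v, θ)) v from funext fun v => (hd v).fderiv]
    exact ih _ (mg_contDiff_slice g hg)

lemma mg_bound_integral {E : Type} [NormedAddCommGroup E] [NormedSpace ℝ E]
    [FiniteDimensional ℝ E] (a b : ℝ) (k : ℕ) :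
    ∀ {G : Type} [NormedAddCommGroup G] [NormedSpace ℝ G] [CompleteSpace G]
    (g : E × ℝ → G) (_ : ContDiff ℝ ∞ g) (v : E) (B : ℝ)
    (_ : ∀ θ ∈ uIcc a b, ‖iteratedFDeriv ℝ k (fun v => g (v, θ)) v‖ ≤ B),
    ‖iteratedFDeriv ℝ k (fun v => ∫ θ in a..b, g (v, θ)) v‖ ≤ B * |b - a| := by
  induction k with
  | zero =>
    intro G _ _ _ g hg v B hB
    simp only [norm_iteratedFDeriv_zero] at hB ⊢
    exact intervalIntegral.norm_integral_le_of_norm_le_const fun θ hθ => hB θ (uIoc_subset_uIcc hθ)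
  | succ k ih =>
    intro G _ _ _ g hg v B hB
    have hd := mg_hasFDerivAt_integral a b g hg
    rw [← norm_iteratedFDeriv_fderiv, show fderiv ℝ (fun v => ∫ θ in a..b, g (v, θ)) =
      fun v => ∫ θ in a..b, fderiv ℝ (fun v => g (v, θ)) v from funext fun v => (hd v).fderiv]
    refine ih (fun q : E × ℝ => fderiv ℝ (fun v => g (v, q.2)) q.1) (mg_contDiff_slice g hg) v B ?_
    intro θ hθ
    have := hB θ hθ
    rw [← norm_iteratedFDeriv_fderiv] at this
    exact this

lemma mg_slice_bound {Par V : Type} [NormedAddCommGroup Par] [NormedSpace ℝ Par]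
    [NormedAddCommGroup V] [NormedSpace ℝ V] (K : Par × V → ℂ)
    (hK : Function.HasTemperateGrowth K) (R : ℝ) (hR : 0 ≤ R) (hv : ∀ p v, R < ‖v‖ → K (p, v) = 0)
    (k : ℕ) : ∃ (N : ℕ) (C : ℝ), 0 ≤ C ∧ ∀ p v,
      ‖iteratedFDeriv ℝ k (fun v => K (p, v)) v‖ ≤ C * (1 + ‖p‖) ^ N := by
  obtain ⟨N, C, hC⟩ := hK.2 k
  have hC0 : 0 ≤ C := by
    have := (norm_nonneg _).trans (hC 0)
    simpa using this
  refine ⟨N, C * (1 + R) ^ N, by positivity, fun p v => ?_⟩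
  by_cases h : R < ‖v‖
  · have : (fun v => K (p, v)) =ᶠ[nhds v] fun _ => 0 := by
      filter_upwards [(isOpen_lt continuous_const continuous_norm).mem_nhds h] with w hw
      exact hv p w hw
    rw [(this.iteratedFDeriv ℝ k).eq_of_nhds]
    have h0 : iteratedFDeriv ℝ k (fun _ : V => (0:ℂ)) v = 0 := by
      rw [iteratedFDeriv_fun_zero]; rfl
    rw [h0, norm_zero]; positivity
  · push Not at h
    have h1 : (fun v => K (p, v)) = (fun u => K (u + (p, 0))) ∘ (ContinuousLinearMap.inr ℝ Par V) := by
      ext w; simp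
    have h2 : ContDiff ℝ ∞ (fun u => K (u + (p, 0))) := hK.1.comp (by fun_prop)
    rw [h1, ContinuousLinearMap.iteratedFDeriv_comp_right _ h2 _ (by exact_mod_cast le_top)]
    refine (ContinuousMultilinearMap.norm_compContinuousLinearMap_le _ _).trans ?_
    have h3 : ∏ i : Fin k, ‖(ContinuousLinearMap.inr ℝ Par V)‖ ≤ 1 :=
      Finset.prod_le_one (fun _ _ => norm_nonneg _) (fun _ _ => ContinuousLinearMap.norm_inr_le_one ℝ Par V)
    refine (mul_le_of_le_one_right (norm_nonneg _) h3).trans ?_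
    rw [iteratedFDeriv_comp_add_right]
    refine (hC _).trans ?_
    rw [mul_assoc, ← mul_pow]
    have h4 : ‖(ContinuousLinearMap.inr ℝ Par V) v + (p, 0)‖ ≤ ‖p‖ + R := by
      simp only [ContinuousLinearMap.inr_apply, Prod.mk_add_mk, zero_add, add_zero, Prod.norm_def]
      exact max_le (by linarith) (by linarith [norm_nonneg p])
    have h5 : 0 ≤ ‖p‖ := norm_nonneg p
    gcongr
    nlinarith

lemma mg_summable_weight : Summable (fun l : ℤ => ((1 + |(l:ℝ)|) ^ 2)⁻¹) := by
  have h := (Real.summable_one_div_int_pow (p := 2)).2 (by norm_num)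
  refine Summable.of_norm_bounded_eventually h ?_
  have : ∀ᶠ l : ℤ in cofinite, l ≠ 0 := by
    exact (Set.finite_singleton (0:ℤ)).subset (fun x hx => by simpa using hx)
  filter_upwards [this] with l hl
  have hl' : (0:ℝ) < |(l:ℝ)| := by positivity
  rw [Real.norm_of_nonneg (by positivity), one_div, ← sq_abs (l:ℝ)]
  gcongr
  linarith

lemma mg_series {ι Par V : Type} [NormedAddCommGroup Par] [NormedSpace ℝ Par]
    [NormedAddCommGroup V] [NormedSpace ℝ V] [FiniteDimensional ℝ V] (K : Par × V → ℂ)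
    (hK : Function.HasTemperateGrowth K) (R : ℝ) (hR : 0 ≤ R) (hv : ∀ p v, R < ‖v‖ → K (p, v) = 0)
    (S : ℤ → Finset ι) (p : ℤ → ι → ℝ → Par) (e : ℤ → ι → ℝ → ℂ)
    (hp : ∀ l c, ContDiff ℝ ∞ (p l c)) (he : ∀ l c, ContDiff ℝ ∞ (e l c))
    (A : ℝ) (hA : 0 ≤ A) (N : ℕ) (hS : ∀ l, ((S l).card : ℝ) ≤ A * (1 + |(l:ℝ)|) ^ N)
    (hpb : ∀ l c θ, c ∈ S l → ‖p l c θ‖ ≤ A * (1 + |(l:ℝ)|) ^ N)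
    (heb : ∀ l c θ, c ∈ S l → ‖e l c θ‖ ≤ A * (1 + |(l:ℝ)|) ^ N)
    (a : ℤ → ℝ → ℂ) (ha : ∀ l, ContDiff ℝ ∞ (a l))
    (hab : ∀ k m : ℕ, ∃ C, ∀ l x, ‖iteratedFDeriv ℝ k (a l) x‖ * (1 + |(l:ℝ)|) ^ m ≤ C) :
    ContDiff ℝ ∞ (fun u : ℝ × V => ∑' l, a l u.1 *
      ∑ c ∈ S l, ∫ θ in (0:ℝ)..(2 * Real.pi), e l c θ * K (p l c θ, u.2)) ∧
    ∀ u : ℝ × V, Summable (fun l => a l u.1 *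
      ∑ c ∈ S l, ∫ θ in (0:ℝ)..(2 * Real.pi), e l c θ * K (p l c θ, u.2)) := by
  set G : ℤ → V → ℂ := fun l v => ∑ c ∈ S l, ∫ θ in (0:ℝ)..(2 * Real.pi), e l c θ * K (p l c θ, v) with hG
  have hg : ∀ l c, ContDiff ℝ ∞ (fun q : V × ℝ => e l c q.2 * K (p l c q.2, q.1)) := by
    intro l c
    exact ((he l c).comp contDiff_snd).mul
      (hK.1.comp (((hp l c).comp contDiff_snd).prodMk contDiff_fst))
  have hI : ∀ l c, ContDiff ℝ ∞ (fun v => ∫ θ in (0:ℝ)..(2 * Real.pi), e l c θ * K (p l c θ, v)) := by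
    intro l c
    rw [contDiff_infty]
    intro k
    exact mg_contDiff_integral 0 (2 * Real.pi) k _ (hg l c)
  have hGs : ∀ l, ContDiff ℝ ∞ (G l) := fun l => ContDiff.sum fun c _ => hI l c
  have hGb : ∀ k, ∃ (C : ℝ) (m : ℕ), 0 ≤ C ∧ ∀ l v, ‖iteratedFDeriv ℝ k (G l) v‖ ≤ C * (1 + |(l:ℝ)|) ^ m := by
    intro k
    obtain ⟨N', C, hC0, hC⟩ := mg_slice_bound K hK R hR hv k
    refine ⟨A * (A * (C * (1 + A) ^ N') * |2 * Real.pi - 0|), N + (N + N * N'), by positivity, fun l v => ?_⟩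
    have hw : 1 ≤ 1 + |(l:ℝ)| := by linarith [abs_nonneg (l:ℝ)]
    set w := 1 + |(l:ℝ)| with hwdef
    have hwN : 1 ≤ w ^ N := one_le_pow₀ hw
    have h1 : iteratedFDeriv ℝ k (G l) v = ∑ c ∈ S l,
        iteratedFDeriv ℝ k (fun v => ∫ θ in (0:ℝ)..(2 * Real.pi), e l c θ * K (p l c θ, v)) v := by
      simp only [hG]
      rw [iteratedFDeriv_sum (fun c _ => (hI l c).of_le (by exact_mod_cast le_top))]
      simp
    rw [h1]
    have h2 : ∀ c ∈ S l, ‖iteratedFDeriv ℝ k (fun v => ∫ θ in (0:ℝ)..(2 * Real.pi), e l c θ * K (p l c θ, v)) v‖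
        ≤ (A * (C * (1 + A) ^ N') * w ^ (N + N * N')) * |2 * Real.pi - 0| := by
      intro c hc
      refine mg_bound_integral 0 (2 * Real.pi) k (fun q : V × ℝ => e l c q.2 * K (p l c q.2, q.1)) (hg l c) v _ ?_
      intro θ hθ
      have hKs : ContDiff ℝ ∞ (fun v => K (p l c θ, v)) := hK.1.comp (by fun_prop)
      have h3 : iteratedFDeriv ℝ k (fun v => e l c θ * K (p l c θ, v)) v =
          e l c θ • iteratedFDeriv ℝ k (fun v => K (p l c θ, v)) v := by
        simp_rw [← smul_eq_mul]
        exact iteratedFDeriv_const_smul_apply' (hKs.contDiffAt.of_le (by exact_mod_cast le_top))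
      rw [h3, norm_smul]
      have h4 := heb l c θ hc
      have h5 := (hC (p l c θ) v)
      have h6 : 1 + ‖p l c θ‖ ≤ (1 + A) * w ^ N := by
        have := hpb l c θ hc
        nlinarith
      calc ‖e l c θ‖ * ‖iteratedFDeriv ℝ k (fun v => K (p l c θ, v)) v‖
          ≤ (A * w ^ N) * (C * ((1 + A) * w ^ N) ^ N') := by
            refine mul_le_mul h4 (h5.trans ?_) (norm_nonneg _) (by positivity)
            gcongr
        _ = _ := by rw [mul_pow, pow_add, pow_mul]; ring
    refine (norm_sum_le _ _).trans ((Finset.sum_le_card_nsmul _ _ _ h2).trans ?_)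
    rw [nsmul_eq_mul]
    calc ((S l).card : ℝ) * ((A * (C * (1 + A) ^ N') * w ^ (N + N * N')) * |2 * Real.pi - 0|)
        ≤ (A * w ^ N) * ((A * (C * (1 + A) ^ N') * w ^ (N + N * N')) * |2 * Real.pi - 0|) := by
          gcongr
          exact hS l
      _ = _ := by rw [pow_add w N]; ring
  have hterm : ∀ k, ∃ C, ∀ l (u : ℝ × V),
      ‖iteratedFDeriv ℝ k (fun u : ℝ × V => a l u.1 * G l u.2) u‖ ≤ C * ((1 + |(l:ℝ)|) ^ 2)⁻¹ := by
    intro k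
    choose C m hC0 hC using hGb
    choose D hD using fun i j => hab i j
    refine ⟨∑ i ∈ Finset.range (k + 1), (k.choose i : ℝ) * (|D i (m (k - i) + 2)| * C (k - i)), fun l u => ?_⟩
    have hw : 1 ≤ 1 + |(l:ℝ)| := by linarith [abs_nonneg (l:ℝ)]
    set w := 1 + |(l:ℝ)| with hwdef
    have ha' : ContDiff ℝ ∞ (fun u : ℝ × V => a l u.1) := (ha l).comp contDiff_fst
    have hG' : ContDiff ℝ ∞ (fun u : ℝ × V => G l u.2) := (hGs l).comp contDiff_snd
    refine (norm_iteratedFDeriv_mul_le ha' hG' u (n := k) (by exact_mod_cast le_top)).trans ?_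
    rw [Finset.sum_mul]
    refine Finset.sum_le_sum fun i _ => ?_
    have e1 : ‖iteratedFDeriv ℝ i (fun u : ℝ × V => a l u.1) u‖ ≤ ‖iteratedFDeriv ℝ i (a l) u.1‖ := by
      have : (fun u : ℝ × V => a l u.1) = a l ∘ (ContinuousLinearMap.fst ℝ ℝ V) := rfl
      rw [this, ContinuousLinearMap.iteratedFDeriv_comp_right _ (ha l) _ (by exact_mod_cast le_top)]
      refine (ContinuousMultilinearMap.norm_compContinuousLinearMap_le _ _).trans ?_
      exact mul_le_of_le_one_right (norm_nonneg _) (Finset.prod_le_one (fun _ _ => norm_nonneg _)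
        (fun _ _ => ContinuousLinearMap.norm_fst_le ..))
    have hle : ∀ j : ℕ, (j : WithTop ℕ∞) ≤ ∞ := fun j => by exact_mod_cast le_top
    have e2 : ‖iteratedFDeriv ℝ (k - i) (fun u : ℝ × V => G l u.2) u‖ ≤ ‖iteratedFDeriv ℝ (k - i) (G l) u.2‖ := by
      have : (fun u : ℝ × V => G l u.2) = G l ∘ (ContinuousLinearMap.snd ℝ ℝ V) := rfl
      rw [this, ContinuousLinearMap.iteratedFDeriv_comp_right _ (hGs l) _ (hle _)]
      refine (ContinuousMultilinearMap.norm_compContinuousLinearMap_le _ _).trans ?_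
      exact mul_le_of_le_one_right (norm_nonneg _) (Finset.prod_le_one (fun _ _ => norm_nonneg _)
        (fun _ _ => ContinuousLinearMap.norm_snd_le ..))
    have e3 := (hD i (m (k - i) + 2) l u.1).trans (le_abs_self _)
    have e4 := hC (k - i) l u.2
    have hw0 : 0 < w := by linarith
    rw [mul_assoc, mul_assoc]
    refine mul_le_mul_of_nonneg_left ?_ (by positivity)
    rw [← div_eq_mul_inv, le_div_iff₀ (by positivity)]
    calc ‖iteratedFDeriv ℝ i (fun u : ℝ × V => a l u.1) u‖ * ‖iteratedFDeriv ℝ (k - i) (fun u : ℝ × V => G l u.2) u‖ * w ^ 2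
        ≤ ‖iteratedFDeriv ℝ i (a l) u.1‖ * (C (k - i) * w ^ m (k - i)) * w ^ 2 := by
          gcongr
          exact e2.trans e4
      _ = (‖iteratedFDeriv ℝ i (a l) u.1‖ * w ^ (m (k - i) + 2)) * C (k - i) := by ring
      _ ≤ _ := by
        gcongr
        exact hC0 _
  choose T hT using hterm
  constructor
  · refine contDiff_tsum (N := ⊤) (v := fun k (l : ℤ) => T k * ((1 + |(l:ℝ)|) ^ 2)⁻¹) ?_ ?_ ?_
    · intro l
      exact ((ha l).comp contDiff_fst).mul ((hGs l).comp contDiff_snd)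
    · intro k _
      exact mg_summable_weight.mul_left _
    · intro k l u _
      exact hT k l u
  · intro u
    refine Summable.of_norm_bounded (mg_summable_weight.mul_left (T 0)) fun l => ?_
    have := hT 0 l u
    rwa [norm_iteratedFDeriv_zero] at this

noncomputable def mgA (g : ℝ × ℝ → ℂ) (l : ℤ) (x : ℝ) : ℂ :=
  ∫ t in (-Real.pi)..Real.pi, g (x, t) * Complex.exp (-(Complex.I * l * t))

lemma mgA_smooth_aux (g : ℝ × ℝ → ℂ) (hg : ContDiff ℝ ∞ g) (l : ℤ) :
    ContDiff ℝ ∞ (fun q : ℝ × ℝ => g q * Complex.exp (-(Complex.I * l * q.2))) := by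
  have h : ContDiff ℝ ∞ (fun q : ℝ × ℝ => (q.2 : ℂ)) := Complex.ofRealCLM.contDiff.comp contDiff_snd
  exact hg.mul ((contDiff_const.mul h).neg.cexp)

lemma mgA_smooth (g : ℝ × ℝ → ℂ) (hg : ContDiff ℝ ∞ g) (l : ℤ) : ContDiff ℝ ∞ (mgA g l) := by
  rw [contDiff_infty]
  intro k
  exact mg_contDiff_integral (-Real.pi) Real.pi k _ (mgA_smooth_aux g hg l)

noncomputable def mgDt (g : ℝ × ℝ → ℂ) (q : ℝ × ℝ) : ℂ := fderiv ℝ g q (0, 1)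

lemma mgDt_smooth (g : ℝ × ℝ → ℂ) (hg : ContDiff ℝ ∞ g) : ContDiff ℝ ∞ (mgDt g) :=
  (hg.fderiv_right (by simp)).clm_apply contDiff_const

lemma mgDt_supp (g : ℝ × ℝ → ℂ) (hg : HasCompactSupport g) : HasCompactSupport (mgDt g) := by
  have := hg.fderiv (𝕜 := ℝ)
  exact this.comp_left (g := fun L : ℝ × ℝ →L[ℝ] ℂ => L (0, 1)) (by simp)

lemma mgDt_zero (g : ℝ × ℝ → ℂ) (hg : ∀ x t, 1 < |t| → g (x, t) = 0) :
    ∀ x t, 1 < |t| → mgDt g (x, t) = 0 := by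
  intro x t ht
  have : g =ᶠ[nhds (x, t)] fun _ => 0 := by
    have ho : IsOpen {q : ℝ × ℝ | 1 < |q.2|} := isOpen_lt continuous_const (by fun_prop)
    filter_upwards [ho.mem_nhds ht] with q hq
    exact hg q.1 q.2 hq
  rw [mgDt, this.fderiv_eq]; simp

lemma mgA_dt (g : ℝ × ℝ → ℂ) (hg : ContDiff ℝ ∞ g) (h0 : ∀ x t, 1 < |t| → g (x, t) = 0)
    (l : ℤ) (x : ℝ) : (Complex.I * l) * mgA g l x = mgA (mgDt g) l x := by
  have hpi : 1 < Real.pi := by linarith [Real.pi_gt_three]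
  have hd : ∀ t : ℝ, HasDerivAt (fun t : ℝ => g (x, t) * Complex.exp (-(Complex.I * l * t)))
      (mgDt g (x, t) * Complex.exp (-(Complex.I * l * t)) +
        g (x, t) * (Complex.exp (-(Complex.I * l * t)) * (-(Complex.I * l)))) t := by
    intro t
    have h1 : HasDerivAt (fun t : ℝ => g (x, t)) (mgDt g (x, t)) t := by
      have h2 : HasFDerivAt g (fderiv ℝ g (x, t)) (x, t) :=
        (hg.differentiable (by simp) _).hasFDerivAt
      exact h2.comp_hasDerivAt t ((hasDerivAt_const t x).prodMk (hasDerivAt_id t))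
    have h3 : HasDerivAt (fun t : ℝ => Complex.exp (-(Complex.I * l * t)))
        (Complex.exp (-(Complex.I * l * t)) * (-(Complex.I * l))) t := by
      have h4 : HasDerivAt (fun t : ℝ => (t : ℂ)) 1 t := Complex.ofRealCLM.hasDerivAt
      have := ((h4.const_mul (Complex.I * l)).neg).cexp
      simpa using this
    exact h1.mul h3
  have c1 : Continuous (fun t : ℝ => mgDt g (x, t) * Complex.exp (-(Complex.I * l * t))) := by
    have := (mgA_smooth_aux _ (mgDt_smooth g hg) l).continuous
    exact this.comp (by fun_prop : Continuous fun t : ℝ => (x, t))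
  have c2 : Continuous (fun t : ℝ => g (x, t) * Complex.exp (-(Complex.I * l * t))) := by
    have := (mgA_smooth_aux _ hg l).continuous
    exact this.comp (by fun_prop : Continuous fun t : ℝ => (x, t))
  have c3 : Continuous (fun t : ℝ => Complex.I * l * (g (x, t) * Complex.exp (-(Complex.I * l * t)))) :=
    continuous_const.mul c2
  have e : ∀ t : ℝ, mgDt g (x, t) * Complex.exp (-(Complex.I * l * t)) +
        g (x, t) * (Complex.exp (-(Complex.I * l * t)) * (-(Complex.I * l))) =
      mgDt g (x, t) * Complex.exp (-(Complex.I * l * t)) -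
       (Complex.I * l) * (g (x, t) * Complex.exp (-(Complex.I * l * t))) := by intro t; ring
  simp_rw [e] at hd
  have := intervalIntegral.integral_eq_sub_of_hasDerivAt (a := -Real.pi) (b := Real.pi) (fun t _ => hd t)
    ((c1.sub c3).intervalIntegrable _ _)
  rw [intervalIntegral.integral_sub (c1.intervalIntegrable _ _)
    (c3.intervalIntegrable _ _), intervalIntegral.integral_const_mul] at this
  rw [h0 x Real.pi (by rwa [abs_of_pos Real.pi_pos]), h0 x (-Real.pi) (by rwa [abs_neg, abs_of_pos Real.pi_pos])] at this
  simp only [zero_mul, sub_zero] at this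
  exact (sub_eq_zero.1 this).symm

lemma mgA_dt_iter (m : ℕ) : ∀ (g : ℝ × ℝ → ℂ), ContDiff ℝ ∞ g → HasCompactSupport g →
    (∀ x t, 1 < |t| → g (x, t) = 0) → ∃ h : ℝ × ℝ → ℂ, ContDiff ℝ ∞ h ∧ HasCompactSupport h ∧
    ∀ (l : ℤ) x, (Complex.I * l) ^ m * mgA g l x = mgA h l x := by
  induction m with
  | zero => intro g h1 h2 _; exact ⟨g, h1, h2, by simp⟩
  | succ m ih =>
    intro g h1 h2 h3
    obtain ⟨h, a, b, c⟩ := ih (mgDt g) (mgDt_smooth g h1) (mgDt_supp g h2) (mgDt_zero g h3)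
    refine ⟨h, a, b, fun l x => ?_⟩
    rw [pow_succ, mul_assoc, mgA_dt g h1 h3, c]

lemma mgA_bound0 (g : ℝ × ℝ → ℂ) (hg : ContDiff ℝ ∞ g) (hs : HasCompactSupport g) (k : ℕ) :
    ∃ C, 0 ≤ C ∧ ∀ (l : ℤ) x, ‖iteratedFDeriv ℝ k (mgA g l) x‖ ≤ C := by
  obtain ⟨B, hB⟩ := (hs.iteratedFDeriv (𝕜 := ℝ) k).exists_bound_of_continuous
    (hg.continuous_iteratedFDeriv (m := k) (by exact_mod_cast le_top))
  have hB0 : 0 ≤ B := (norm_nonneg _).trans (hB 0)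
  refine ⟨B * |Real.pi - -Real.pi|, by positivity, fun l x => ?_⟩
  refine mg_bound_integral (-Real.pi) Real.pi k _ (mgA_smooth_aux g hg l) x B ?_
  intro t _
  have hsl : ContDiff ℝ ∞ (fun v : ℝ => g (v, t)) := hg.comp (by fun_prop)
  have e1 : (fun v : ℝ => g (v, t) * Complex.exp (-(Complex.I * l * t))) =
      (Complex.exp (-(Complex.I * l * t))) • (fun v : ℝ => g (v, t)) := by
    ext v; simp [mul_comm]
  show ‖iteratedFDeriv ℝ k (fun v : ℝ => g (v, t) * Complex.exp (-(Complex.I * l * t))) x‖ ≤ B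
  rw [e1, iteratedFDeriv_const_smul_apply (hsl.contDiffAt.of_le (by exact_mod_cast le_top)), norm_smul]
  have e2 : ‖Complex.exp (-(Complex.I * l * t))‖ = 1 := by
    rw [Complex.norm_exp]; simp
  rw [e2, one_mul]
  have h1 : (fun v : ℝ => g (v, t)) = (fun u => g (u + (0, t))) ∘ (ContinuousLinearMap.inl ℝ ℝ ℝ) := by
    ext w; simp
  have h2 : ContDiff ℝ ∞ (fun u => g (u + (0, t))) := hg.comp (by fun_prop)
  rw [h1, ContinuousLinearMap.iteratedFDeriv_comp_right _ h2 _ (by exact_mod_cast le_top)]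
  refine (ContinuousMultilinearMap.norm_compContinuousLinearMap_le _ _).trans ?_
  have h3 : ∏ i : Fin k, ‖(ContinuousLinearMap.inl ℝ ℝ ℝ)‖ ≤ 1 :=
    Finset.prod_le_one (fun _ _ => norm_nonneg _) (fun _ _ => ContinuousLinearMap.norm_inl_le_one ℝ ℝ ℝ)
  refine (mul_le_of_le_one_right (norm_nonneg _) h3).trans ?_
  rw [iteratedFDeriv_comp_add_right]
  exact hB _

lemma mgA_bound (g : ℝ × ℝ → ℂ) (hg : ContDiff ℝ ∞ g) (hs : HasCompactSupport g)
    (h0 : ∀ x t, 1 < |t| → g (x, t) = 0) (k m : ℕ) :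
    ∃ C, ∀ (l : ℤ) x, ‖iteratedFDeriv ℝ k (mgA g l) x‖ * (1 + |(l:ℝ)|) ^ m ≤ C := by
  obtain ⟨h, a, b, c⟩ := mgA_dt_iter m g hg hs h0
  obtain ⟨C1, hC1, h1⟩ := mgA_bound0 g hg hs k
  obtain ⟨C2, hC2, h2⟩ := mgA_bound0 h a b k
  refine ⟨2 ^ (m - 1) * (C1 + C2), fun l x => ?_⟩
  have e : mgA h l = ((Complex.I * l) ^ m) • mgA g l := by
    ext x; rw [← c]; rfl
  have h3 := h2 l x
  rw [e, iteratedFDeriv_const_smul_apply ((mgA_smooth g hg l).contDiffAt.of_le (by exact_mod_cast le_top)),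
    norm_smul, norm_pow, norm_mul, Complex.norm_I, one_mul, Complex.norm_intCast] at h3
  have h4 := h1 l x
  have h5 := add_pow_le (zero_le_one (α := ℝ)) (abs_nonneg (l:ℝ)) m
  calc _ ≤ ‖iteratedFDeriv ℝ k (mgA g l) x‖ * (2 ^ (m - 1) * (1 ^ m + |(l:ℝ)| ^ m)) := by gcongr
    _ = 2 ^ (m - 1) * (‖iteratedFDeriv ℝ k (mgA g l) x‖ + |(l:ℝ)| ^ m * ‖iteratedFDeriv ℝ k (mgA g l) x‖) := by ring
    _ ≤ _ := by gcongr

lemma mg_fourier (g : ℝ × ℝ → ℂ) (hg : ContDiff ℝ ∞ g) (hs : HasCompactSupport g)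
    (h0 : ∀ x t, 1 < |t| → g (x, t) = 0) :
    ∃ a : ℤ → ℝ → ℂ, (∀ l, ContDiff ℝ ∞ (a l)) ∧
    (∀ k m : ℕ, ∃ C, ∀ l x, ‖iteratedFDeriv ℝ k (a l) x‖ * (1 + |(l:ℝ)|) ^ m ≤ C) ∧
    ∀ x y : ℝ, |y| ≤ 1 / 2 → HasSum (fun l => a l x * Complex.exp (Complex.I * l * y)) (g (x, y)) := by
  have hpi : 1 < Real.pi := by linarith [Real.pi_gt_three]
  refine ⟨fun l => ((1 / (2 * Real.pi) : ℝ) : ℂ) • mgA g l, fun l => ?_, ?_, ?_⟩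
  · show ContDiff ℝ ∞ (fun x => ((1 / (2 * Real.pi) : ℝ) : ℂ) • mgA g l x)
    exact (mgA_smooth g hg l).const_smul _
  · intro k m
    obtain ⟨C, hC⟩ := mgA_bound g hg hs h0 k m
    refine ⟨‖((1 / (2 * Real.pi) : ℝ) : ℂ)‖ * C, fun l x => ?_⟩
    show ‖iteratedFDeriv ℝ k (((1 / (2 * Real.pi) : ℝ) : ℂ) • mgA g l) x‖ * _ ≤ _
    rw [iteratedFDeriv_const_smul_apply ((mgA_smooth g hg l).contDiffAt.of_le (by exact_mod_cast le_top)),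
      norm_smul, mul_assoc]
    exact mul_le_mul_of_nonneg_left (hC l x) (norm_nonneg _)
  · intro x y hy
    have hT : Fact (0 < 2 * Real.pi) := ⟨by positivity⟩
    let f : ℝ → ℂ := fun t => g (x, t)
    have hfc : Continuous f := hg.continuous.comp (by fun_prop)
    have hper : f (-Real.pi) = f (-Real.pi + 2 * Real.pi) := by
      show g _ = g _
      rw [h0 x (-Real.pi) (by rwa [abs_neg, abs_of_pos Real.pi_pos]), h0]
      rw [show -Real.pi + 2 * Real.pi = Real.pi by ring]; rwa [abs_of_pos Real.pi_pos]
    let F : C(AddCircle (2 * Real.pi), ℂ) := ⟨AddCircle.liftIco (2 * Real.pi) (-Real.pi) f,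
      AddCircle.liftIco_continuous hper hfc.continuousOn⟩
    have hco : ∀ l : ℤ, fourierCoeff F l = ((1 / (2 * Real.pi) : ℝ) : ℂ) * mgA g l x := by
      intro l
      show fourierCoeff (AddCircle.liftIco (2 * Real.pi) (-Real.pi) f) l = _
      rw [fourierCoeff_liftIco_eq, fourierCoeffOn_eq_integral, mgA]
      rw [show -Real.pi + 2 * Real.pi = Real.pi by ring, show Real.pi - -Real.pi = 2 * Real.pi by ring]
      rw [Complex.real_smul]
      congr 1
      refine intervalIntegral.integral_congr fun t _ => ?_
      simp only [fourier_coe_apply, smul_eq_mul]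
      rw [mul_comm]
      congr 2
      push_cast
      have : (Real.pi : ℂ) ≠ 0 := by exact_mod_cast Real.pi_ne_zero
      field_simp
    have hsum : Summable (fourierCoeff F) := by
      obtain ⟨C, hC⟩ := mgA_bound g hg hs h0 0 2
      refine Summable.of_norm_bounded (g := fun l : ℤ => (‖((1 / (2 * Real.pi) : ℝ) : ℂ)‖ * C) * ((1 + |(l:ℝ)|) ^ 2)⁻¹)
        (mg_summable_weight.mul_left _) fun l => ?_
      rw [hco, norm_mul, mul_assoc]
      have := hC l x
      rw [norm_iteratedFDeriv_zero] at this
      have hp : 0 < (1 + |(l:ℝ)|) ^ 2 := by positivity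
      refine mul_le_mul_of_nonneg_left ?_ (norm_nonneg _)
      rw [← div_eq_mul_inv, le_div_iff₀ hp]
      exact this
    have := has_pointwise_sum_fourier_series_of_summable hsum (y : AddCircle (2 * Real.pi))
    have hy' := abs_le.1 hy
    have e : F (y : AddCircle (2 * Real.pi)) = g (x, y) := by
      show AddCircle.liftIco (2 * Real.pi) (-Real.pi) f y = _
      rw [AddCircle.liftIco_coe_apply]
      constructor <;> linarith
    rw [e] at this
    convert this using 2 with l
    rw [hco, fourier_coe_apply, smul_eq_mul]
    congr 2
    push_cast
    have : (Real.pi : ℂ) ≠ 0 := by exact_mod_cast Real.pi_ne_zero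
    field_simp

noncomputable def mgP {n : ℕ} (lam : Fin n → ℝ) (z : ℂ) : ℂ := z ^ n + ∑ i, (lam i : ℂ) * z ^ (i : ℕ)

noncomputable def mgR {n : ℕ} (lam : Fin n → ℝ) (j : Fin n) (z : ℂ) : ℂ :=
  z ^ (n - 1 - (j : ℕ)) + ∑ m : Fin n, if j < m then (lam m : ℂ) * z ^ ((m : ℕ) - 1 - (j : ℕ)) else 0

lemma mgP_sub {n : ℕ} (lam : Fin n → ℝ) (z y : ℂ) :
    mgP lam z - mgP lam y = (z - y) * ∑ j, mgR lam j z * y ^ (j : ℕ) := by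
  have h1 : ∀ k : ℕ, z ^ k - y ^ k = (z - y) * ∑ j ∈ Finset.range k, y ^ j * z ^ (k - 1 - j) := by
    intro k
    have := geom_sum₂_mul y z k
    rw [eq_comm, ← neg_sub y z, neg_mul, mul_comm, neg_eq_iff_eq_neg, this]; ring
  have h2 : z ^ n - y ^ n = (z - y) * ∑ j : Fin n, z ^ (n - 1 - (j : ℕ)) * y ^ (j : ℕ) := by
    rw [h1, Finset.sum_range]
    congr 1
    exact Finset.sum_congr rfl fun j _ => mul_comm _ _
  have h3 : ∀ m : Fin n, z ^ (m : ℕ) - y ^ (m : ℕ) = (z - y) * ∑ j : Fin n,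
      (if j < m then z ^ ((m : ℕ) - 1 - (j : ℕ)) else 0) * y ^ (j : ℕ) := by
    intro m
    rw [h1]
    congr 1
    have : ∑ j : Fin n, (if j < m then z ^ ((m : ℕ) - 1 - (j : ℕ)) else 0) * y ^ (j : ℕ) =
        ∑ j ∈ Finset.range n, (if j < m then z ^ ((m : ℕ) - 1 - j) else 0) * y ^ j := by
      rw [Finset.sum_range]; rfl
    rw [this]
    rw [← Finset.sum_subset (Finset.range_subset_range.2 m.2.le)]
    · refine Finset.sum_congr rfl fun j hj => ?_
      rw [if_pos (Finset.mem_range.1 hj), mul_comm]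
    · intro j _ hj
      rw [if_neg (by simpa using hj), zero_mul]
  unfold mgP mgR
  have h4 : z ^ n + ∑ i, (lam i : ℂ) * z ^ (i : ℕ) - (y ^ n + ∑ i, (lam i : ℂ) * y ^ (i : ℕ)) =
      (z ^ n - y ^ n) + ∑ i, (lam i : ℂ) * (z ^ (i : ℕ) - y ^ (i : ℕ)) := by
    simp only [mul_sub, Finset.sum_sub_distrib]; ring
  rw [h4, h2]
  simp_rw [h3, add_mul, Finset.sum_add_distrib, mul_add]
  congr 1
  simp_rw [Finset.mul_sum, Finset.sum_mul, Finset.mul_sum]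
  rw [Finset.sum_comm]
  refine Finset.sum_congr rfl fun j _ => Finset.sum_congr rfl fun m _ => ?_
  split_ifs <;> ring

lemma mg_dist {W ρ d x : ℝ} (hρ : 1 ≤ ρ) (hW : ρ ≤ W) (hd : 0 ≤ d) (h : 1 / 2 ≤ |d ^ 2 - ρ ^ 2|)
    (hx : |d - ρ| ≤ x) : 1 ≤ x * (6 * W) := by
  have h1 : |d ^ 2 - ρ ^ 2| = |d - ρ| * (d + ρ) := by
    rw [show d ^ 2 - ρ ^ 2 = (d - ρ) * (d + ρ) by ring, abs_mul, abs_of_nonneg (by linarith : 0 ≤ d + ρ)]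
  rw [h1] at h
  have h0 : 0 ≤ |d - ρ| := abs_nonneg _
  by_cases h2 : d ≤ 2 * ρ
  · nlinarith
  · push Not at h2
    have : d - ρ ≤ |d - ρ| := le_abs_self _
    nlinarith

lemma mg_multiset_lower (z : ℂ) (δ : ℝ) (hδ : 0 ≤ δ) (m : Multiset ℂ) :
    (∀ r ∈ m, 1 ≤ ‖z - r‖ * δ) → 1 ≤ ‖(m.map (fun r => z - r)).prod‖ * δ ^ m.card := by
  induction m using Multiset.induction with
  | empty => intro _; simp
  | cons a m ih =>
    intro h
    have h1 := h a (Multiset.mem_cons_self a m)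
    have h2 := ih fun r hr => h r (Multiset.mem_cons_of_mem hr)
    rw [Multiset.map_cons, Multiset.prod_cons, norm_mul, Multiset.card_cons, pow_succ]
    calc (1:ℝ) = 1 * 1 := by ring
      _ ≤ (‖z - a‖ * δ) * (‖(m.map (fun r => z - r)).prod‖ * δ ^ m.card) :=
        mul_le_mul h1 h2 zero_le_one (by linarith)
      _ = _ := by ring

lemma mgP_roots {n : ℕ} (lam : Fin n → ℝ) : ∃ m : Multiset ℂ, m.card = n ∧
    ∀ z, mgP lam z = (m.map (fun r => z - r)).prod := by
  classical
  let q : Polynomial ℂ := ∑ i : Fin n, Polynomial.C (lam i : ℂ) * Polynomial.X ^ (i : ℕ)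
  let p : Polynomial ℂ := Polynomial.X ^ n + q
  have hq : q.degree < n := by
    refine lt_of_le_of_lt (Polynomial.degree_sum_le _ _) ?_
    rw [Finset.sup_lt_iff (by exact_mod_cast WithBot.bot_lt_coe n)]
    intro i _
    refine lt_of_le_of_lt (Polynomial.degree_C_mul_X_pow_le _ _) ?_
    exact_mod_cast i.2
  have hp : p.Monic := Polynomial.monic_X_pow_add hq
  have hdeg : p.natDegree = n := by
    apply Polynomial.natDegree_eq_of_degree_eq_some
    rw [Polynomial.degree_add_eq_left_of_degree_lt] <;> simp [hq]
  have hs : p.Splits := IsAlgClosed.splits p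
  refine ⟨p.roots, ?_, ?_⟩
  · rw [← hdeg]; exact hs.natDegree_eq_card_roots.symm
  · intro z
    rw [← hs.eval_eq_prod_roots_of_monic hp]
    simp [p, q, mgP, Polynomial.eval_finsetSum]

/-- circle radius -/
noncomputable def mgRad (l : ℤ) (s : ℕ) : ℝ := Real.sqrt ((l:ℝ) ^ 2 + s)

noncomputable def mgW (n : ℕ) (l : ℤ) : ℕ := l.natAbs + n + 2

lemma mgW_cast (n : ℕ) (l : ℤ) : (mgW n l : ℝ) = |(l:ℝ)| + n + 2 := by
  simp [mgW, Nat.cast_natAbs]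

lemma mgRad_sq (l : ℤ) (s : ℕ) : mgRad l s ^ 2 = (l:ℝ) ^ 2 + s := Real.sq_sqrt (by positivity)

lemma mgRad_ge (l : ℤ) (s : ℕ) (hs : 1 ≤ s) : 1 ≤ mgRad l s := by
  have : (1:ℝ) ≤ s := by exact_mod_cast hs
  apply Real.le_sqrt_of_sq_le
  nlinarith [sq_nonneg (l:ℝ)]

lemma mgRad_le (n : ℕ) (l : ℤ) (s : ℕ) (hs : s ≤ n + 1) : mgRad l s ≤ mgW n l := by
  have h : (s:ℝ) ≤ n + 1 := by exact_mod_cast hs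
  have h2 : (0:ℝ) ≤ n := by positivity
  rw [mgW_cast]
  apply Real.sqrt_le_iff.2
  refine ⟨by positivity, ?_⟩
  have := abs_nonneg (l:ℝ)
  rw [← sq_abs (l:ℝ)]
  nlinarith

lemma mg_choose {n : ℕ} (lam : Fin n → ℝ) (l : ℤ) : ∃ s : ℕ, 1 ≤ s ∧ s ≤ n + 1 ∧
    ∀ z : ℂ, ‖z - Complex.I * l‖ = mgRad l s → 1 ≤ ‖mgP lam z‖ * (6 * (mgW n l : ℝ)) ^ n := by
  classical
  obtain ⟨m, hm, hP⟩ := mgP_roots lam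
  have key : ∃ s ∈ Finset.Icc 1 (n + 1), ∀ r ∈ m.toFinset,
      1 / 2 ≤ |‖r - Complex.I * l‖ ^ 2 - (l:ℝ) ^ 2 - s| := by
    by_contra hcon
    push Not at hcon
    choose! g hg1 hg2 using hcon
    have hcard : m.toFinset.card < (Finset.Icc 1 (n + 1)).card := by
      have := Multiset.toFinset_card_le m
      simp; omega
    obtain ⟨s, hs, t, ht, hst, he⟩ := Finset.exists_ne_map_eq_of_card_lt_of_maps_to hcard
      (fun s hs => hg1 s hs)
    have a1 := abs_lt.1 (hg2 s hs)
    have a2 := abs_lt.1 (hg2 t ht)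
    rw [he] at a1
    have b1 : (s:ℝ) < t + 1 := by linarith
    have b2 : (t:ℝ) < s + 1 := by linarith
    have c1 : s < t + 1 := by exact_mod_cast b1
    have c2 : t < s + 1 := by exact_mod_cast b2
    omega
  obtain ⟨s, hs, hr⟩ := key
  rw [Finset.mem_Icc] at hs
  refine ⟨s, hs.1, hs.2, fun z hz => ?_⟩
  rw [hP, ← hm]
  have : (mgW (m.card) l : ℝ) = mgW n l := by rw [hm]
  rw [this]
  apply mg_multiset_lower _ _ (by positivity)
  intro r hrm
  refine mg_dist (mgRad_ge l s hs.1) (mgRad_le n l s hs.2) (norm_nonneg (r - Complex.I * l)) ?_ ?_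
  · rw [mgRad_sq, ← sub_sub]; exact hr r (by simpa using hrm)
  · rw [← hz, norm_sub_rev z r]
    calc _ ≤ ‖(r - Complex.I * l) - (z - Complex.I * l)‖ := abs_norm_sub_norm_le _ _
      _ = _ := by congr 1; ring

noncomputable def mgM (n : ℕ) (l : ℤ) : ℕ := (12 * mgW n l) ^ (2 * n + 2)

lemma mg_norm_z (n : ℕ) (l : ℤ) (s : ℕ) (hs' : s ≤ n + 1) (z : ℂ)
    (hz : ‖z - Complex.I * l‖ = mgRad l s) : ‖z‖ ≤ 2 * mgW n l := by
  have h1 := mgRad_le n l s hs'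
  have h2 : ‖(Complex.I * l : ℂ)‖ ≤ mgW n l := by
    rw [norm_mul, Complex.norm_I, one_mul, Complex.norm_intCast, mgW_cast]
    have : (0:ℝ) ≤ n := by positivity
    linarith
  have := norm_le_norm_sub_add z (Complex.I * l)
  linarith

lemma mg_lower_near {n : ℕ} (lam lam' : Fin n → ℝ) (l : ℤ) (s : ℕ) (hs : s ≤ n + 1) (z : ℂ)
    (hz : ‖z - Complex.I * l‖ = mgRad l s) (h : 1 ≤ ‖mgP lam z‖ * (6 * (mgW n l : ℝ)) ^ n)
    (hl : ∀ i, |lam' i - lam i| * mgM n l ≤ 2) : 1 ≤ ‖mgP lam' z‖ * mgM n l := by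
  have hW : (n:ℝ) + 2 ≤ mgW n l := by rw [mgW_cast]; linarith [abs_nonneg (l:ℝ)]
  have hz2 := mg_norm_z n l s hs z hz
  set W : ℝ := (mgW n l : ℝ) with hWd
  have hn : (0:ℝ) ≤ n := by positivity
  have hM : (mgM n l : ℝ) = (12 * W) ^ 2 * ((12 * W) ^ n * (12 * W) ^ n) := by
    rw [mgM]; push_cast; rw [← hWd]; ring
  set M : ℝ := (mgM n l : ℝ) with hMd
  have hW0 : 0 < W := by linarith
  have hM0 : 0 < M := by rw [hM]; positivity
  have hdiff : ‖mgP lam z - mgP lam' z‖ * M ≤ 2 * n * (2 * W) ^ n := by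
    have e : mgP lam z - mgP lam' z = ∑ i, ((lam i - lam' i : ℝ) : ℂ) * z ^ (i : ℕ) := by
      unfold mgP
      push_cast
      simp only [sub_mul, Finset.sum_sub_distrib]; ring
    rw [e]
    calc ‖∑ i, ((lam i - lam' i : ℝ) : ℂ) * z ^ (i : ℕ)‖ * M
        ≤ (∑ i : Fin n, ‖((lam i - lam' i : ℝ) : ℂ) * z ^ (i : ℕ)‖) * M := by
          gcongr; exact norm_sum_le _ _
      _ = ∑ i : Fin n, (|lam' i - lam i| * M) * ‖z‖ ^ (i : ℕ) := by
          rw [Finset.sum_mul]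
          refine Finset.sum_congr rfl fun i _ => ?_
          rw [norm_mul, norm_pow, Complex.norm_real, Real.norm_eq_abs, abs_sub_comm]; ring
      _ ≤ ∑ i : Fin n, 2 * (2 * W) ^ n := by
          refine Finset.sum_le_sum fun i _ => ?_
          have e1 : ‖z‖ ^ (i : ℕ) ≤ (2 * W) ^ n :=
            (pow_le_pow_left₀ (norm_nonneg z) hz2 _).trans
              (pow_le_pow_right₀ (by linarith) i.2.le)
          exact mul_le_mul (hl i) e1 (by positivity) (by norm_num)
      _ = _ := by simp; ring
  have hmain : (2 * n + 1) * (2 * W) ^ n ≤ ‖mgP lam z‖ * M := by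
    have a1 : (2 * (n:ℝ) + 1) ≤ (12 * W) ^ 2 := by nlinarith
    have a2 : (2 * W) ^ n ≤ (12 * W) ^ n := pow_le_pow_left₀ (by linarith) (by linarith) _
    have a3 : (6 * W) ^ n ≤ (12 * W) ^ n := pow_le_pow_left₀ (by linarith) (by linarith) _
    calc (2 * n + 1) * (2 * W) ^ n = (2 * n + 1) * (2 * W) ^ n * 1 := by ring
      _ ≤ (2 * n + 1) * (2 * W) ^ n * (‖mgP lam z‖ * (6 * W) ^ n) := by gcongr
      _ = ‖mgP lam z‖ * ((2 * n + 1) * ((2 * W) ^ n * (6 * W) ^ n)) := by ring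
      _ ≤ ‖mgP lam z‖ * ((12 * W) ^ 2 * ((12 * W) ^ n * (12 * W) ^ n)) := by gcongr
      _ = _ := by rw [hM]
  have h1 : 1 ≤ (2 * W) ^ n := one_le_pow₀ (by linarith)
  have h2 := norm_le_norm_sub_add (mgP lam z) (mgP lam' z)
  nlinarith

lemma mg_lower_y (n : ℕ) (l : ℤ) (s : ℕ) (hs1 : 1 ≤ s) (hs : s ≤ n + 1) (z : ℂ) (y : ℝ)
    (hy : |y| ≤ 1 / 2) (hz : ‖z - Complex.I * l‖ = mgRad l s) : 1 ≤ ‖z - y‖ * mgM n l := by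
  have hW : (n:ℝ) + 2 ≤ mgW n l := by rw [mgW_cast]; linarith [abs_nonneg (l:ℝ)]
  have hn : (0:ℝ) ≤ n := by positivity
  have hyl : ‖(y:ℂ) - Complex.I * l‖ ^ 2 = y ^ 2 + (l:ℝ) ^ 2 := by
    rw [← Complex.normSq_eq_norm_sq, Complex.normSq_apply]; simp; ring
  have h1 : 1 ≤ ‖z - y‖ * (6 * mgW n l) := by
    refine mg_dist (mgRad_ge l s hs1) (mgRad_le n l s hs) (norm_nonneg ((y:ℂ) - Complex.I * l)) ?_ ?_
    · rw [mgRad_sq, hyl, le_abs]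
      right
      have : (1:ℝ) ≤ s := by exact_mod_cast hs1
      have h3 : y ^ 2 ≤ 1 / 4 := by rw [← sq_abs]; nlinarith [abs_nonneg y]
      linarith
    · rw [← hz, norm_sub_rev z y]
      calc _ ≤ ‖((y:ℂ) - Complex.I * l) - (z - Complex.I * l)‖ := abs_norm_sub_norm_le _ _
        _ = _ := by congr 1; ring
  refine h1.trans ?_
  gcongr
  rw [mgM]; push_cast
  calc 6 * (mgW n l : ℝ) ≤ 12 * mgW n l := by linarith
    _ = (12 * (mgW n l : ℝ)) ^ 1 := by ring
    _ ≤ _ := pow_le_pow_right₀ (by linarith) (by omega)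

lemma mg_exp_bound (l : ℤ) (s : ℕ) (z : ℂ) (hz : ‖z - Complex.I * l‖ = mgRad l s) :
    ‖Complex.exp (Complex.I * l * z)‖ ≤ Real.exp s := by
  rw [Complex.norm_exp, Real.exp_le_exp]
  have h := mgRad_sq l s
  rw [← hz, ← Complex.normSq_eq_norm_sq, Complex.normSq_apply] at h
  simp at h ⊢
  have : (0:ℝ) ≤ s := by positivity
  nlinarith [sq_nonneg z.re, sq_nonneg z.im]

lemma mg_cauchy (l : ℤ) (s : ℕ) (hs1 : 1 ≤ s) (y : ℝ) (hy : |y| ≤ 1 / 2) :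
    (∮ z in C(Complex.I * l, mgRad l s), Complex.exp (Complex.I * l * z) * (z - y)⁻¹) =
      2 * Real.pi * Complex.I * Complex.exp (Complex.I * l * y) := by
  have hd : DifferentiableOn ℂ (fun z => Complex.exp (Complex.I * l * z))
      (Metric.closedBall (Complex.I * l) (mgRad l s)) := by
    apply Differentiable.differentiableOn; fun_prop
  have hm : (y:ℂ) ∈ Metric.ball (Complex.I * l) (mgRad l s) := by
    rw [mem_ball_iff_norm]
    apply lt_of_pow_lt_pow_left₀ 2 (Real.sqrt_nonneg _)
    have hyl : ‖(y:ℂ) - Complex.I * l‖ ^ 2 = y ^ 2 + (l:ℝ) ^ 2 := by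
      rw [← Complex.normSq_eq_norm_sq, Complex.normSq_apply]; simp; ring
    have h2 := mgRad_sq l s
    have : (1:ℝ) ≤ s := by exact_mod_cast hs1
    have h3 : y ^ 2 ≤ 1 / 4 := by rw [← sq_abs]; nlinarith [abs_nonneg y]
    show _ < mgRad l s ^ 2
    rw [hyl, h2]; linarith
  have := hd.circleIntegral_sub_inv_smul hm
  simp only [smul_eq_mul] at this
  rw [← this]
  congr 1; ext z; ring


lemma mg_temp_prod {E ι : Type} [NormedAddCommGroup E] [NormedSpace ℝ E] (s : Finset ι)
    (f : ι → E → ℝ) (hf : ∀ i, Function.HasTemperateGrowth (f i)) :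
    Function.HasTemperateGrowth (fun x => ∏ i ∈ s, f i x) := by
  classical
  induction s using Finset.induction with
  | empty =>
    simp only [Finset.prod_empty]
    exact Function.HasTemperateGrowth.const (E := E) (1:ℝ)
  | insert a s ha ih =>
    simp_rw [Finset.prod_insert ha]
    exact (hf a).mul ih

lemma mg_temp_fst {E A B : Type} [NormedAddCommGroup E] [NormedSpace ℝ E]
    [NormedAddCommGroup A] [NormedSpace ℝ A] [NormedAddCommGroup B] [NormedSpace ℝ B]
    {f : E → A × B} (hf : Function.HasTemperateGrowth f) :
    Function.HasTemperateGrowth (fun x => (f x).1) :=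
  ((ContinuousLinearMap.fst ℝ A B).hasTemperateGrowth).comp hf

lemma mg_temp_snd {E A B : Type} [NormedAddCommGroup E] [NormedSpace ℝ E]
    [NormedAddCommGroup A] [NormedSpace ℝ A] [NormedAddCommGroup B] [NormedSpace ℝ B]
    {f : E → A × B} (hf : Function.HasTemperateGrowth f) :
    Function.HasTemperateGrowth (fun x => (f x).2) :=
  ((ContinuousLinearMap.snd ℝ A B).hasTemperateGrowth).comp hf

lemma mg_temp_apply {E : Type} {n : ℕ} [NormedAddCommGroup E] [NormedSpace ℝ E]
    (f : E → Fin n → ℝ) (hf : Function.HasTemperateGrowth f) (j : Fin n) :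
    Function.HasTemperateGrowth (fun x => f x j) :=
  ((ContinuousLinearMap.proj (R := ℝ) (φ := fun _ : Fin n => ℝ) j).hasTemperateGrowth).comp hf

lemma mg_temp_cast {E : Type} [NormedAddCommGroup E] [NormedSpace ℝ E]
    (f : E → ℝ) (hf : Function.HasTemperateGrowth f) :
    Function.HasTemperateGrowth (fun x => (f x : ℂ)) :=
  (Complex.ofRealCLM.hasTemperateGrowth).comp hf

lemma mg_temp_P {E : Type} {n : ℕ} [NormedAddCommGroup E] [NormedSpace ℝ E]
    (f : E → Fin n → ℝ) (hf : Function.HasTemperateGrowth f)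
    (z : E → ℂ) (hz : Function.HasTemperateGrowth z) :
    Function.HasTemperateGrowth (fun x => mgP (f x) (z x)) := by
  unfold mgP
  refine (hz.pow n).add ?_
  apply Function.HasTemperateGrowth.sum (f := fun (i : Fin n) x => (f x i : ℂ) * z x ^ (i : ℕ))
  intro i _
  exact (mg_temp_cast _ (mg_temp_apply f hf i)).mul (hz.pow _)

lemma mg_temp_R {E : Type} {n : ℕ} [NormedAddCommGroup E] [NormedSpace ℝ E]
    (f : E → Fin n → ℝ) (hf : Function.HasTemperateGrowth f)
    (z : E → ℂ) (hz : Function.HasTemperateGrowth z) (j : Fin n) :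
    Function.HasTemperateGrowth (fun x => mgR (f x) j (z x)) := by
  unfold mgR
  refine (hz.pow _).add ?_
  apply Function.HasTemperateGrowth.sum (f := fun (m : Fin n) x => if j < m then (f x m : ℂ) * z x ^ ((m : ℕ) - 1 - (j : ℕ)) else 0)
  intro i _
  by_cases h : j < i
  · simp only [h, if_true]
    exact (mg_temp_cast _ (mg_temp_apply f hf i)).mul (hz.pow _)
  · simp only [h, if_false]
    exact Function.HasTemperateGrowth.const _

noncomputable def mgCell {n : ℕ} (β χ : ℝ → ℝ) (M : ℝ) (c lam : Fin n → ℝ) : ℝ :=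
  ∏ j, (β (lam j) * χ (M * lam j - c j))

lemma mg_temp_cell {E : Type} {n : ℕ} [NormedAddCommGroup E] [NormedSpace ℝ E] (β χ : ℝ → ℝ)
    (hβ : Function.HasTemperateGrowth β) (hχ : Function.HasTemperateGrowth χ)
    (M : E → ℝ) (hM : Function.HasTemperateGrowth M)
    (c : E → Fin n → ℝ) (hc : Function.HasTemperateGrowth c)
    (f : E → Fin n → ℝ) (hf : Function.HasTemperateGrowth f) :
    Function.HasTemperateGrowth (fun x => (mgCell β χ (M x) (c x) (f x) : ℂ)) := by
  apply mg_temp_cast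
  unfold mgCell
  apply mg_temp_prod
  intro i
  exact (hβ.comp (mg_temp_apply f hf i)).mul (hχ.comp
    ((hM.mul (mg_temp_apply f hf i)).sub (mg_temp_apply c hc i)))

abbrev mgPar (n : ℕ) := ℝ × (Fin n → ℝ) × ℂ

noncomputable def mgKR {n : ℕ} (κ : ℂ → ℂ) (β χ : ℝ → ℝ) (j : Fin n) (q : mgPar n × (Fin n → ℝ)) : ℂ :=
  mgCell β χ q.1.1 q.1.2.1 q.2 * (q.1.1 * κ (q.1.1 * mgP q.2 q.1.2.2)) * mgR q.2 j q.1.2.2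

noncomputable def mgKQ {n : ℕ} (κ : ℂ → ℂ) (β χ : ℝ → ℝ) (q : mgPar n × (ℝ × (Fin n → ℝ))) : ℂ :=
  mgCell β χ q.1.1 q.1.2.1 q.2.2 * (q.1.1 * κ (q.1.1 * mgP q.2.2 q.1.2.2)) *
    ((β q.2.1 : ℂ) * (q.1.1 * κ (q.1.1 * (q.1.2.2 - q.2.1))))

lemma mgKR_temp {n : ℕ} (κ : ℂ → ℂ) (β χ : ℝ → ℝ) (j : Fin n) (hκ : Function.HasTemperateGrowth κ)
    (hβ : Function.HasTemperateGrowth β) (hχ : Function.HasTemperateGrowth χ) :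
    Function.HasTemperateGrowth (mgKR κ β χ j) := by
  unfold mgKR
  have hid : Function.HasTemperateGrowth (fun q : mgPar n × (Fin n → ℝ) => q) := Function.HasTemperateGrowth.id'
  have h1 : Function.HasTemperateGrowth (fun q : mgPar n × (Fin n → ℝ) => q.1.1) :=
    mg_temp_fst (mg_temp_fst hid)
  have h2 : Function.HasTemperateGrowth (fun q : mgPar n × (Fin n → ℝ) => q.1.2.1) :=
    mg_temp_fst (mg_temp_snd (mg_temp_fst hid))
  have h3 : Function.HasTemperateGrowth (fun q : mgPar n × (Fin n → ℝ) => q.1.2.2) :=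
    mg_temp_snd (mg_temp_snd (mg_temp_fst hid))
  have h4 : Function.HasTemperateGrowth (fun q : mgPar n × (Fin n → ℝ) => q.2) :=
    mg_temp_snd hid
  exact ((mg_temp_cell β χ hβ hχ _ h1 _ h2 _ h4).mul
    ((mg_temp_cast _ h1).mul (hκ.comp ((mg_temp_cast _ h1).mul (mg_temp_P _ h4 _ h3))))).mul
    (mg_temp_R _ h4 _ h3 j)

lemma mgKQ_temp {n : ℕ} (κ : ℂ → ℂ) (β χ : ℝ → ℝ) (hκ : Function.HasTemperateGrowth κ)
    (hβ : Function.HasTemperateGrowth β) (hχ : Function.HasTemperateGrowth χ) :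
    Function.HasTemperateGrowth (mgKQ (n := n) κ β χ) := by
  unfold mgKQ
  have hid : Function.HasTemperateGrowth (fun q : mgPar n × (ℝ × (Fin n → ℝ)) => q) := Function.HasTemperateGrowth.id'
  have h1 : Function.HasTemperateGrowth (fun q : mgPar n × (ℝ × (Fin n → ℝ)) => q.1.1) :=
    mg_temp_fst (mg_temp_fst hid)
  have h2 : Function.HasTemperateGrowth (fun q : mgPar n × (ℝ × (Fin n → ℝ)) => q.1.2.1) :=
    mg_temp_fst (mg_temp_snd (mg_temp_fst hid))
  have h3 : Function.HasTemperateGrowth (fun q : mgPar n × (ℝ × (Fin n → ℝ)) => q.1.2.2) :=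
    mg_temp_snd (mg_temp_snd (mg_temp_fst hid))
  have h4 : Function.HasTemperateGrowth (fun q : mgPar n × (ℝ × (Fin n → ℝ)) => q.2.2) :=
    mg_temp_snd (mg_temp_snd hid)
  have h5 : Function.HasTemperateGrowth (fun q : mgPar n × (ℝ × (Fin n → ℝ)) => q.2.1) :=
    mg_temp_fst (mg_temp_snd hid)
  exact ((mg_temp_cell β χ hβ hχ _ h1 _ h2 _ h4).mul
    ((mg_temp_cast _ h1).mul (hκ.comp ((mg_temp_cast _ h1).mul (mg_temp_P _ h4 _ h3))))).mul
    ((mg_temp_cast _ (hβ.comp h5)).mul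
    ((mg_temp_cast _ h1).mul (hκ.comp ((mg_temp_cast _ h1).mul (h3.sub (mg_temp_cast _ h5))))))

lemma mgCell_zero {n : ℕ} (β χ : ℝ → ℝ) (hβ : ∀ t, β t ≠ 0 → |t| ≤ 1) (M : ℝ) (c lam : Fin n → ℝ)
    (h : 1 < ‖lam‖) : mgCell β χ M c lam = 0 := by
  have : ∃ j, 1 < |lam j| := by
    by_contra hcon
    push Not at hcon
    have : ‖lam‖ ≤ 1 := (pi_norm_le_iff_of_nonneg zero_le_one).2 hcon
    linarith
  obtain ⟨j, hj⟩ := this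
  apply Finset.prod_eq_zero (Finset.mem_univ j)
  have : β (lam j) = 0 := by
    by_contra h2
    linarith [hβ _ h2]
  rw [this, zero_mul]

lemma mgKR_zero {n : ℕ} (κ : ℂ → ℂ) (β χ : ℝ → ℝ) (j : Fin n) (hβ : ∀ t, β t ≠ 0 → |t| ≤ 1)
    (p : mgPar n) (v : Fin n → ℝ) (h : 1 < ‖v‖) : mgKR κ β χ j (p, v) = 0 := by
  simp only [mgKR, mgCell_zero β χ hβ _ _ v h]; simp

lemma mgKQ_zero {n : ℕ} (κ : ℂ → ℂ) (β χ : ℝ → ℝ) (hβ : ∀ t, β t ≠ 0 → |t| ≤ 1)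
    (p : mgPar n) (v : ℝ × (Fin n → ℝ)) (h : 1 < ‖v‖) : mgKQ κ β χ (p, v) = 0 := by
  rw [Prod.norm_def, lt_max_iff] at h
  rcases h with h | h
  · have : β v.1 = 0 := by
      by_contra h2
      have := hβ _ h2
      rw [Real.norm_eq_abs] at h
      linarith
    simp [mgKQ, this]
  · simp [mgKQ, mgCell_zero β χ hβ _ _ v.2 h]

/-- pointwise identity on the circles -/
lemma mg_kernel_identity {n : ℕ} (κ : ℂ → ℂ) (β χ : ℝ → ℝ) (hκ : ∀ z, 1 ≤ ‖z‖ → κ z = z⁻¹)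
    (hβ : ∀ t, |t| ≤ 1 / 2 → β t = 1) (hχ : ∀ t, χ t ≠ 0 → |t| ≤ 2) (l : ℤ) (s : ℕ) (hs1 : 1 ≤ s)
    (hs : s ≤ n + 1) (c : Fin n → ℝ) (z : ℂ) (hz : ‖z - Complex.I * l‖ = mgRad l s)
    (hc : 1 ≤ ‖mgP (fun j => c j / mgM n l) z‖ * (6 * (mgW n l : ℝ)) ^ n)
    (y : ℝ) (hy : |y| ≤ 1 / 2) (lam : Fin n → ℝ) (hl : ∀ i, |lam i| ≤ 1 / 2) :
    mgKQ κ β χ (((mgM n l : ℝ), c, z), (y, lam)) * mgP lam y +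
      ∑ j, mgKR κ β χ j (((mgM n l : ℝ), c, z), lam) * (y : ℂ) ^ (j : ℕ) =
      ((∏ j, χ ((mgM n l : ℝ) * lam j - c j) : ℝ) : ℂ) * (z - y)⁻¹ := by
  have hcell : mgCell β χ (mgM n l : ℝ) c lam = ∏ j, χ ((mgM n l : ℝ) * lam j - c j) := by
    unfold mgCell
    refine Finset.prod_congr rfl fun j _ => ?_
    rw [hβ _ (hl j), one_mul]
  simp only [mgKQ, mgKR, hcell]
  by_cases h0 : ∏ j, χ ((mgM n l : ℝ) * lam j - c j) = 0
  · rw [h0]; simp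
  · have hne : ∀ j, χ ((mgM n l : ℝ) * lam j - c j) ≠ 0 := fun j =>
      Finset.prod_ne_zero_iff.1 h0 j (Finset.mem_univ j)
    have hM0 : (0:ℝ) < mgM n l := by
      have : 0 < mgM n l := by unfold mgM mgW; positivity
      exact_mod_cast this
    have hlow := mg_lower_near _ lam l s hs z hz hc (fun i => by
      have := hχ _ (hne i)
      rw [← abs_of_pos hM0, ← abs_mul]
      refine le_trans (le_of_eq ?_) this
      congr 1
      rw [abs_of_pos hM0]
      field_simp)
    have hlowy := mg_lower_y n l s hs1 hs z y hy hz
    have hMc : ((mgM n l : ℝ) : ℂ) ≠ 0 := by exact_mod_cast hM0.ne'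
    have hP : mgP lam z ≠ 0 := by
      intro h; rw [h] at hlow; simp at hlow; linarith
    have hzy : z - y ≠ 0 := by
      intro h; rw [h] at hlowy; simp at hlowy; linarith
    have k1 : κ ((mgM n l : ℝ) * mgP lam z) = ((mgM n l : ℝ) * mgP lam z)⁻¹ := by
      apply hκ
      rw [norm_mul, Complex.norm_real, Real.norm_eq_abs, abs_of_pos hM0, mul_comm]; exact hlow
    have k2 : κ ((mgM n l : ℝ) * (z - y)) = ((mgM n l : ℝ) * (z - y))⁻¹ := by
      apply hκ
      rw [norm_mul, Complex.norm_real, Real.norm_eq_abs, abs_of_pos hM0, mul_comm]; exact hlowy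
    rw [k1, k2, hβ y hy]
    simp_rw [mul_assoc, ← Finset.mul_sum]
    have hsub := mgP_sub lam z y
    have e : mgP lam y = mgP lam z - (z - y) * ∑ j, mgR lam j z * (y:ℂ) ^ (j : ℕ) := by
      rw [← hsub]; ring
    rw [e]
    generalize ∑ j, mgR lam j z * (y:ℂ) ^ (j : ℕ) = T
    generalize ((∏ j, χ ((mgM n l : ℝ) * lam j - c j) : ℝ) : ℂ) = X
    generalize ((mgM n l : ℝ) : ℂ) = m at *
    generalize mgP lam z = P at *
    generalize z - y = d at *
    push_cast
    field_simp
    ring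


/-- shifted grid index -/
noncomputable def mgC (n : ℕ) (l : ℤ) (c : Fin n → ℕ) : Fin n → ℝ := fun j => (c j : ℝ) - mgM n l - 1

noncomputable def mgZ (n : ℕ) (s : ℤ → (Fin n → ℕ) → ℕ) (l : ℤ) (c : Fin n → ℕ) (θ : ℝ) : ℂ :=
  circleMap (Complex.I * l) (mgRad l (s l c)) θ

noncomputable def mgS (n : ℕ) (l : ℤ) : Finset (Fin n → ℕ) :=
  Fintype.piFinset fun _ => Finset.range (2 * mgM n l + 3)

noncomputable def mgp (n : ℕ) (s : ℤ → (Fin n → ℕ) → ℕ) (l : ℤ) (c : Fin n → ℕ) (θ : ℝ) : mgPar n :=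
  ((mgM n l : ℝ), mgC n l c, mgZ n s l c θ)

noncomputable def mge (n : ℕ) (s : ℤ → (Fin n → ℕ) → ℕ) (l : ℤ) (c : Fin n → ℕ) (θ : ℝ) : ℂ :=
  (2 * Real.pi * Complex.I)⁻¹ * (circleMap 0 (mgRad l (s l c)) θ * Complex.I *
    Complex.exp (Complex.I * l * mgZ n s l c θ))

lemma mgRad_nonneg (l : ℤ) (s : ℕ) : 0 ≤ mgRad l s := Real.sqrt_nonneg _

lemma mgZ_norm (n : ℕ) (s : ℤ → (Fin n → ℕ) → ℕ) (l : ℤ) (c : Fin n → ℕ) (θ : ℝ) :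
    ‖mgZ n s l c θ - Complex.I * l‖ = mgRad l (s l c) := by
  have h := circleMap_sub_center (Complex.I * (l:ℂ)) (mgRad l (s l c)) θ
  rw [mgZ, h, norm_circleMap_zero, abs_of_nonneg (mgRad_nonneg _ _)]

lemma mgZ_smooth (n : ℕ) (s : ℤ → (Fin n → ℕ) → ℕ) (l : ℤ) (c : Fin n → ℕ) :
    ContDiff ℝ ∞ (mgZ n s l c) := contDiff_circleMap _ _

lemma mgp_smooth (n : ℕ) (s : ℤ → (Fin n → ℕ) → ℕ) (l : ℤ) (c : Fin n → ℕ) :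
    ContDiff ℝ ∞ (mgp n s l c) :=
  contDiff_const.prodMk (contDiff_const.prodMk (mgZ_smooth n s l c))

lemma mge_smooth (n : ℕ) (s : ℤ → (Fin n → ℕ) → ℕ) (l : ℤ) (c : Fin n → ℕ) :
    ContDiff ℝ ∞ (mge n s l c) := 
  contDiff_const.mul (((contDiff_circleMap _ _).mul contDiff_const).mul
    (contDiff_const.mul (mgZ_smooth n s l c)).cexp)

lemma mgM_ge (n : ℕ) (l : ℤ) : 12 * (mgW n l : ℝ) ≤ mgM n l := by
  have hW : (2:ℝ) ≤ mgW n l := by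
    rw [mgW_cast]; have : (0:ℝ) ≤ n := by positivity
    linarith [abs_nonneg (l:ℝ)]
  rw [mgM]; push_cast
  calc _ = (12 * (mgW n l : ℝ)) ^ 1 := by ring
    _ ≤ _ := pow_le_pow_right₀ (by linarith) (by omega)

lemma mgM_one (n : ℕ) (l : ℤ) : (24:ℝ) ≤ mgM n l := by
  have := mgM_ge n l
  have hW : (2:ℝ) ≤ mgW n l := by
    rw [mgW_cast]; have : (0:ℝ) ≤ n := by positivity
    linarith [abs_nonneg (l:ℝ)]
  linarith

lemma mg_unif_bound (n : ℕ) (l : ℤ) : (5 * (mgM n l : ℝ)) ^ (n + 1) ≤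
    (5 * (12 * ((n:ℝ) + 2)) ^ (2 * n + 2)) ^ (n + 1) * (1 + |(l:ℝ)|) ^ ((2 * n + 2) * (n + 1)) := by
  rw [pow_mul, ← mul_pow, mul_assoc, ← mul_pow]
  have h0 := abs_nonneg (l:ℝ)
  have h1 : (mgW n l : ℝ) ≤ ((n:ℝ) + 2) * (1 + |(l:ℝ)|) := by
    rw [mgW_cast]; have : (0:ℝ) ≤ n := by positivity
    nlinarith
  apply pow_le_pow_left₀ (by positivity)
  rw [mgM]; push_cast
  gcongr 5 * ?_ ^ _
  linarith

lemma mgS_card (n : ℕ) (l : ℤ) : ((mgS n l).card : ℝ) ≤ (5 * (mgM n l : ℝ)) ^ (n + 1) := by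
  have h := mgM_one n l
  rw [mgS, Fintype.card_piFinset_const, Finset.card_range]
  push_cast
  calc (2 * (mgM n l : ℝ) + 3) ^ n ≤ (5 * (mgM n l : ℝ)) ^ n := by gcongr; linarith
    _ ≤ _ := pow_le_pow_right₀ (by linarith) (by omega)

lemma mgp_bound (n : ℕ) (s : ℤ → (Fin n → ℕ) → ℕ) (hs : ∀ l c, s l c ≤ n + 1) (l : ℤ) (c : Fin n → ℕ) (θ : ℝ)
    (hc : c ∈ mgS n l) : ‖mgp n s l c θ‖ ≤ (5 * (mgM n l : ℝ)) ^ (n + 1) := by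
  have h := mgM_one n l
  have h' := mgM_ge n l
  have h2 : ‖mgp n s l c θ‖ ≤ 5 * (mgM n l : ℝ) := by
    rw [mgp, Prod.norm_def, Prod.norm_def]
    refine max_le ?_ (max_le ?_ ?_)
    · simp; linarith
    · rw [pi_norm_le_iff_of_nonneg (by positivity)]
      intro j
      have hj := Finset.mem_range.1 (Fintype.mem_piFinset.1 hc j)
      have hj' : (c j : ℝ) < 2 * mgM n l + 3 := by exact_mod_cast hj
      have : (0:ℝ) ≤ c j := by positivity
      show ‖(c j : ℝ) - mgM n l - 1‖ ≤ _
      rw [Real.norm_eq_abs, abs_le]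
      constructor <;> linarith
    · have := mg_norm_z n l (s l c) (hs l c) _ (mgZ_norm n s l c θ)
      simp only
      have : (0:ℝ) ≤ mgW n l := by positivity
      linarith
  refine h2.trans ?_
  calc _ = (5 * (mgM n l : ℝ)) ^ 1 := by ring
    _ ≤ _ := pow_le_pow_right₀ (by linarith) (by omega)

lemma mge_bound (n : ℕ) (s : ℤ → (Fin n → ℕ) → ℕ) (hs : ∀ l c, s l c ≤ n + 1) (l : ℤ) (c : Fin n → ℕ) (θ : ℝ) :
    ‖mge n s l c θ‖ ≤ Real.exp (n + 1) * (5 * (mgM n l : ℝ)) ^ (n + 1) := by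
  have h := mgM_one n l
  have h' := mgM_ge n l
  have h1 := mg_exp_bound l (s l c) _ (mgZ_norm n s l c θ)
  have h2 : Real.exp (s l c) ≤ Real.exp (n + 1) := by
    rw [Real.exp_le_exp]; exact_mod_cast hs l c
  have h3 := mgRad_le n l (s l c) (hs l c)
  have h4 : mgRad l (s l c) ≤ (5 * (mgM n l : ℝ)) ^ (n + 1) := by
    calc _ ≤ (5 * (mgM n l : ℝ)) ^ 1 := by
            have : (0:ℝ) ≤ mgW n l := by positivity
            linarith
      _ ≤ _ := pow_le_pow_right₀ (by linarith) (by omega)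
  have h5 : ‖((2 * Real.pi * Complex.I)⁻¹ : ℂ)‖ ≤ 1 := by
    rw [norm_inv]
    apply inv_le_one_of_one_le₀
    simp [abs_of_pos Real.pi_pos]
    linarith [Real.pi_gt_three]
  rw [mge, norm_mul, norm_mul, norm_mul, Complex.norm_I, norm_circleMap_zero, abs_of_nonneg (mgRad_nonneg _ _)]
  have h0 : 0 ≤ mgRad l (s l c) := Real.sqrt_nonneg _
  calc _ ≤ 1 * ((5 * (mgM n l : ℝ)) ^ (n + 1) * 1 * Real.exp (n + 1)) := by
        gcongr
        exact h1.trans h2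
    _ = _ := by ring

lemma mg_cells {n : ℕ} (χ : ℝ → ℝ) (hχ : ∀ (M : ℕ) (t : ℝ), |t| ≤ M →
      ∑ k ∈ Finset.range (2 * M + 3), χ (t - ((k : ℝ) - M - 1)) = 1) (l : ℤ) (lam : Fin n → ℝ)
    (hl : ∀ i, |lam i| ≤ 1 / 2) :
    ∑ c ∈ mgS n l, ∏ j, χ ((mgM n l : ℝ) * lam j - mgC n l c j) = 1 := by
  unfold mgS mgC
  have := Finset.prod_univ_sum (fun _ : Fin n => Finset.range (2 * mgM n l + 3))
    (fun j k => χ ((mgM n l : ℝ) * lam j - ((k : ℝ) - mgM n l - 1)))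
  rw [← this]
  apply Finset.prod_eq_one
  intro j _
  apply hχ
  rw [abs_mul, abs_of_nonneg (by positivity)]
  have := hl j
  have : (0:ℝ) ≤ mgM n l := by positivity
  nlinarith

set_option maxHeartbeats 1000000 in
lemma mg_cell_integral {n : ℕ} (κ : ℂ → ℂ) (β χ : ℝ → ℝ) (hκt : Function.HasTemperateGrowth κ)
    (hβt : Function.HasTemperateGrowth β) (hχt : Function.HasTemperateGrowth χ)
    (hκ : ∀ z, 1 ≤ ‖z‖ → κ z = z⁻¹)
    (hβ : ∀ t, |t| ≤ 1 / 2 → β t = 1) (hχ : ∀ t, χ t ≠ 0 → |t| ≤ 2) 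
    (s : ℤ → (Fin n → ℕ) → ℕ) (hs1 : ∀ l c, 1 ≤ s l c) (hs : ∀ l c, s l c ≤ n + 1)
    (hsz : ∀ (l : ℤ) (c : Fin n → ℕ) (z : ℂ), ‖z - Complex.I * l‖ = mgRad l (s l c) →
      1 ≤ ‖mgP (fun j => mgC n l c j / mgM n l) z‖ * (6 * (mgW n l : ℝ)) ^ n)
    (l : ℤ) (c : Fin n → ℕ)
    (y : ℝ) (hy : |y| ≤ 1 / 2) (lam : Fin n → ℝ) (hl : ∀ i, |lam i| ≤ 1 / 2) :
    (∫ θ in (0:ℝ)..(2 * Real.pi), mge n s l c θ * mgKQ κ β χ (mgp n s l c θ, (y, lam))) * mgP lam y +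
      ∑ j, (∫ θ in (0:ℝ)..(2 * Real.pi), mge n s l c θ * mgKR κ β χ j (mgp n s l c θ, lam)) * (y : ℂ) ^ (j : ℕ) =
      ((∏ j, χ ((mgM n l : ℝ) * lam j - mgC n l c j) : ℝ) : ℂ) * Complex.exp (Complex.I * l * y) := by
  have cp := (mgp_smooth n s l c).continuous
  have ce := (mge_smooth n s l c).continuous
  have cQ : Continuous (fun θ => mge n s l c θ * mgKQ κ β χ (mgp n s l c θ, (y, lam))) :=
    ce.mul ((mgKQ_temp κ β χ hκt hβt hχt).1.continuous.comp (cp.prodMk continuous_const))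
  have cR : ∀ j, Continuous (fun θ => mge n s l c θ * mgKR κ β χ j (mgp n s l c θ, lam)) := fun j =>
    ce.mul ((mgKR_temp κ β χ j hκt hβt hχt).1.continuous.comp (cp.prodMk continuous_const))
  simp_rw [← intervalIntegral.integral_mul_const]
  rw [← intervalIntegral.integral_finsetSum, ← intervalIntegral.integral_add]
  rotate_left
  · exact (cQ.mul continuous_const).intervalIntegrable _ _
  · exact (continuous_finsetSum _ fun j _ => (cR j).mul continuous_const).intervalIntegrable _ _
  · exact fun j _ => ((cR j).mul continuous_const).intervalIntegrable _ _
  have key : ∀ θ, mge n s l c θ * mgKQ κ β χ (mgp n s l c θ, (y, lam)) * mgP lam y +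
      ∑ j, mge n s l c θ * mgKR κ β χ j (mgp n s l c θ, lam) * (y : ℂ) ^ (j : ℕ) =
      (((∏ j, χ ((mgM n l : ℝ) * lam j - mgC n l c j) : ℝ) : ℂ) * (2 * Real.pi * Complex.I)⁻¹) *
      (deriv (circleMap (Complex.I * l) (mgRad l (s l c))) θ • 
        (Complex.exp (Complex.I * l * mgZ n s l c θ) * (mgZ n s l c θ - y)⁻¹)) := by
    intro θ
    have := mg_kernel_identity κ β χ hκ hβ hχ l (s l c) (hs1 l c) (hs l c) (mgC n l c) (mgZ n s l c θ)
      (mgZ_norm n s l c θ) (hsz l c _ (mgZ_norm n s l c θ)) y hy lam hl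
    simp_rw [mul_assoc, ← Finset.mul_sum, ← mul_add]
    rw [mgp, this, mge, deriv_circleMap, smul_eq_mul]
    ring_nf
  rw [intervalIntegral.integral_congr fun θ _ => key θ, intervalIntegral.integral_const_mul]
  have h2 := mg_cauchy l (s l c) (hs1 l c) y hy
  rw [circleIntegral] at h2
  unfold mgZ
  rw [h2]
  have : (2 * Real.pi * Complex.I : ℂ) ≠ 0 := Complex.two_pi_I_ne_zero
  field_simp

lemma mg_division (n : ℕ) (g : ℝ × ℝ → ℂ) (hg : ContDiff ℝ ∞ g) (hsupp : HasCompactSupport g)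
    (h0 : ∀ x t, 1 < |t| → g (x, t) = 0) :
    ∃ (Q : ℝ × (ℝ × (Fin n → ℝ)) → ℂ) (R : Fin n → ℝ × (Fin n → ℝ) → ℂ),
      ContDiff ℝ ∞ Q ∧ (∀ j, ContDiff ℝ ∞ (R j)) ∧
      ∀ x y lam, |y| ≤ 1 / 2 → (∀ i, |lam i| ≤ 1 / 2) →
        g (x, y) = Q (x, (y, lam)) * mgP lam y + ∑ j, R j (x, lam) * (y : ℂ) ^ (j : ℕ) := by
  obtain ⟨a, ha1, ha2, ha3⟩ := mg_fourier g hg hsupp h0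
  obtain ⟨κ, hκt, hκ⟩ := mg_exists_iota
  obtain ⟨χ, hχt, hχ, hχs⟩ := mg_exists_chi
  obtain ⟨β, hβt, hβ0, hβ⟩ := mg_exists_bump
  have hex : ∀ (l : ℤ) (c : Fin n → ℕ), ∃ s : ℕ, 1 ≤ s ∧ s ≤ n + 1 ∧
    ∀ z : ℂ, ‖z - Complex.I * l‖ = mgRad l s →
      1 ≤ ‖mgP (fun j => mgC n l c j / mgM n l) z‖ * (6 * (mgW n l : ℝ)) ^ n :=
    fun l c => mg_choose _ l
  choose s hs1 hs2 hsz using hex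
  set D : ℝ := (5 * (12 * ((n:ℝ) + 2)) ^ (2 * n + 2)) ^ (n + 1) with hD
  set N : ℕ := (2 * n + 2) * (n + 1) with hN
  have hD0 : 0 ≤ D := by positivity
  have he1 : 1 ≤ Real.exp ((n:ℝ) + 1) := Real.one_le_exp (by positivity)
  have hbd : ∀ l : ℤ, (5 * (mgM n l : ℝ)) ^ (n + 1) ≤ (Real.exp (n + 1) * D) * (1 + |(l:ℝ)|) ^ N := by
    intro l
    refine (mg_unif_bound n l).trans ?_
    gcongr
    nlinarith
  have hS : ∀ l : ℤ, ((mgS n l).card : ℝ) ≤ (Real.exp (n + 1) * D) * (1 + |(l:ℝ)|) ^ N :=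
    fun l => (mgS_card n l).trans (hbd l)
  have hp : ∀ l c θ, c ∈ mgS n l → ‖mgp n s l c θ‖ ≤ (Real.exp (n + 1) * D) * (1 + |(l:ℝ)|) ^ N :=
    fun l c θ hc => (mgp_bound n s hs2 l c θ hc).trans (hbd l)
  have he : ∀ l c θ, c ∈ mgS n l → ‖mge n s l c θ‖ ≤ (Real.exp (n + 1) * D) * (1 + |(l:ℝ)|) ^ N := by
    intro l c θ _
    refine (mge_bound n s hs2 l c θ).trans ?_
    rw [mul_assoc]
    gcongr
    exact mg_unif_bound n l
  have hQ := mg_series (mgKQ (n := n) κ β χ) (mgKQ_temp κ β χ hκt hβt hχt) 1 zero_le_one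
    (mgKQ_zero κ β χ hβ0) (mgS n) (mgp n s) (mge n s) (mgp_smooth n s) (mge_smooth n s)
    (Real.exp (n + 1) * D) (by positivity) N hS hp he a ha1 ha2
  have hR := fun j => mg_series (mgKR (n := n) κ β χ j) (mgKR_temp κ β χ j hκt hβt hχt) 1 zero_le_one
    (mgKR_zero κ β χ j hβ0) (mgS n) (mgp n s) (mge n s) (mgp_smooth n s) (mge_smooth n s)
    (Real.exp (n + 1) * D) (by positivity) N hS hp he a ha1 ha2
  refine ⟨_, _, hQ.1, fun j => (hR j).1, ?_⟩
  intro x y lam hy hl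
  have s1 := ((hQ.2 (x, (y, lam))).hasSum).mul_right (mgP lam y)
  have s2 := hasSum_sum (s := Finset.univ) fun j (_ : j ∈ Finset.univ) =>
    (((hR j).2 (x, lam)).hasSum).mul_right ((y : ℂ) ^ (j : ℕ))
  have s3 := s1.add s2
  refine (ha3 x y hy).unique ?_
  refine HasSum.congr_fun s3 (fun l => ?_)
  have hk : Complex.exp (Complex.I * l * y) =
      (∑ c ∈ mgS n l, ∫ θ in (0:ℝ)..(2 * Real.pi), mge n s l c θ * mgKQ κ β χ (mgp n s l c θ, (y, lam))) * mgP lam y +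
      ∑ j, (∑ c ∈ mgS n l, ∫ θ in (0:ℝ)..(2 * Real.pi), mge n s l c θ * mgKR κ β χ j (mgp n s l c θ, lam)) *
        (y : ℂ) ^ (j : ℕ) := by
    simp_rw [Finset.sum_mul]
    rw [Finset.sum_comm, ← Finset.sum_add_distrib]
    rw [Finset.sum_congr rfl fun c _ => mg_cell_integral κ β χ hκt hβt hχt hκ hβ hχ s hs1 hs2 hsz l c y hy lam hl]
    rw [← Finset.sum_mul, ← Complex.ofReal_sum, mg_cells χ hχs l lam hl]; simp
  rw [hk, mul_add, Finset.mul_sum]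
  simp only [mul_assoc]


lemma mg_division_real (n : ℕ) (f : ℝ × ℝ → ℝ) (hf : ContDiff ℝ ∞ f) (hsupp : HasCompactSupport f)
    (h0 : ∀ x t, 1 < |t| → f (x, t) = 0) :
    ∃ (Q : ℝ × (ℝ × (Fin n → ℝ)) → ℝ) (R : ℝ × (Fin n → ℝ) → (Fin n → ℝ)),
      ContDiff ℝ ∞ Q ∧ ContDiff ℝ ∞ R ∧
      ∀ x y lam, |y| ≤ 1 / 2 → (∀ i, |lam i| ≤ 1 / 2) →
        f (x, y) = Q (x, (y, lam)) * (y ^ n + ∑ i, lam i * y ^ (i : ℕ)) +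
          ∑ j, R (x, lam) j * y ^ (j : ℕ) := by
  obtain ⟨Q, R, hQ, hR, h⟩ := mg_division n (fun p => (f p : ℂ))
    (Complex.ofRealCLM.contDiff.comp hf)
    (hsupp.comp_left (g := fun r : ℝ => (r : ℂ)) (by simp))
    (by intro x t ht; simp [h0 x t ht])
  refine ⟨fun p => (Q p).re, fun p j => (R j p).re, Complex.reCLM.contDiff.comp hQ,
    contDiff_pi.2 fun j => Complex.reCLM.contDiff.comp (hR j), ?_⟩
  intro x y lam hy hlam
  have e := congrArg Complex.re (h x y lam hy hlam)
  have e1 : mgP lam (y : ℂ) = ((y ^ n + ∑ i, lam i * y ^ (i : ℕ) : ℝ) : ℂ) := by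
    unfold mgP; push_cast; rfl
  rw [e1] at e
  simp only [Complex.ofReal_re, Complex.add_re, Complex.re_mul_ofReal, Complex.re_sum] at e
  rw [e]
  congr 1
  refine Finset.sum_congr rfl fun j _ => ?_
  rw [← Complex.ofReal_pow, Complex.re_mul_ofReal]

lemma mg_poly (n : ℕ) : ∀ (a : Fin n → ℝ) (h : ℝ → ℝ) (L : ℝ)
    (_ : Tendsto h (nhdsWithin 0 {0}ᶜ) (nhds L))
    (_ : ∀ᶠ y in nhdsWithin (0:ℝ) {0}ᶜ, ∑ j, a j * y ^ (j : ℕ) = h y * y ^ n), a = 0 ∧ L = 0 := by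
  induction n with
  | zero =>
    intro a h L hL he
    refine ⟨Subsingleton.elim _ _, ?_⟩
    refine tendsto_nhds_unique hL ?_
    refine (tendsto_const_nhds (x := (0:ℝ))).congr' ?_
    filter_upwards [he] with y hy
    simpa using hy
  | succ n ih =>
    intro a h L hL he
    have hid : Tendsto (fun y : ℝ => y) (nhdsWithin 0 {0}ᶜ) (nhds 0) :=
      tendsto_id.mono_left nhdsWithin_le_nhds
    have ha0 : a 0 = 0 := by
      have t1 : Tendsto (fun y => h y * y ^ (n+1)) (nhdsWithin 0 {0}ᶜ) (nhds (L * 0 ^ (n+1))) :=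
        hL.mul (hid.pow _)
      have t2 : Tendsto (fun y : ℝ => ∑ j, a j * y ^ (j : ℕ)) (nhdsWithin 0 {0}ᶜ)
          (nhds (∑ j, a j * 0 ^ (j : ℕ))) :=
        tendsto_finsetSum _ fun j _ => tendsto_const_nhds.mul (hid.pow _)
      have := tendsto_nhds_unique (t2.congr' he) t1
      simpa [Fin.sum_univ_succ] using this
    obtain ⟨h1, h2⟩ := ih (fun j => a j.succ) h L hL (by
      filter_upwards [he, self_mem_nhdsWithin] with y hy hy0
      rw [Fin.sum_univ_succ, ha0] at hy
      have hy0 : y ≠ 0 := hy0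
      apply mul_right_cancel₀ hy0
      rw [mul_assoc, ← pow_succ, ← hy, Finset.sum_mul]
      simp [pow_succ, mul_assoc])
    refine ⟨?_, h2⟩
    funext j
    refine Fin.cases ha0 (fun j => ?_) j
    exact congrFun h1 j

lemma mg_prep_point {n : ℕ} {f : ℝ × ℝ → ℝ} {Q : ℝ × (ℝ × (Fin n → ℝ)) → ℝ}
    {R : ℝ × (Fin n → ℝ) → (Fin n → ℝ)} (hQ : ContDiff ℝ ∞ Q)
    (h : ∀ x y lam, |y| ≤ 1 / 2 → (∀ i, |lam i| ≤ 1 / 2) →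
        f (x, y) = Q (x, (y, lam)) * (y ^ n + ∑ i, lam i * y ^ (i : ℕ)) +
          ∑ j, R (x, lam) j * y ^ (j : ℕ)) {c : ℝ}
    (hasymp : (fun y : ℝ => f (0, y) - c * y ^ n) =o[nhds 0] fun y : ℝ => y ^ n) :
    R (0, 0) = 0 ∧ Q (0, (0, 0)) = c := by
  have hQc : Tendsto (fun y : ℝ => Q (0, (y, 0))) (nhdsWithin 0 {0}ᶜ) (nhds (Q (0, (0, 0)))) := by
    have : Continuous (fun y : ℝ => Q (0, (y, 0))) := by
      have := hQ.continuous
      fun_prop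
    exact this.continuousAt.tendsto.mono_left nhdsWithin_le_nhds
  have ht := (hasymp.mono nhdsWithin_le_nhds (l := nhdsWithin 0 {0}ᶜ)).tendsto_div_nhds_zero
  have hsm : ∀ᶠ y in nhdsWithin (0:ℝ) {0}ᶜ, |y| ≤ 1/2 := by
    apply nhdsWithin_le_nhds
    filter_upwards [Metric.closedBall_mem_nhds (0:ℝ) (by norm_num : (0:ℝ) < 1/2)] with y hy
    simpa using hy
  obtain ⟨h1, h2⟩ := mg_poly n (R (0,0)) (fun y => (f (0, y) - c * y ^ n) / y ^ n + c - Q (0, (y, 0)))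
    (0 + c - Q (0, (0, 0))) ((ht.add_const c).sub hQc) (by
      filter_upwards [hsm, self_mem_nhdsWithin] with y hy hy0
      have hy0 : y ≠ 0 := hy0
      have e := h 0 y 0 hy (by intro i; simp)
      simp only [Pi.zero_apply, zero_mul, Finset.sum_const_zero, add_zero] at e
      have e2 : ∑ j, R (0, 0) j * y ^ (j : ℕ) = f (0, y) - Q (0, (y, 0)) * y ^ n := by
        rw [e]; ring
      rw [e2]
      field_simp
      ring)
  exact ⟨h1, by linarith⟩

lemma mg_prep_inj {n : ℕ} {f : ℝ × ℝ → ℝ} {Q : ℝ × (ℝ × (Fin n → ℝ)) → ℝ}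
    {R : ℝ × (Fin n → ℝ) → (Fin n → ℝ)} (hQ : ContDiff ℝ ∞ Q) (hR : ContDiff ℝ ∞ R)
    (h : ∀ x y lam, |y| ≤ 1 / 2 → (∀ i, |lam i| ≤ 1 / 2) →
        f (x, y) = Q (x, (y, lam)) * (y ^ n + ∑ i, lam i * y ^ (i : ℕ)) +
          ∑ j, R (x, lam) j * y ^ (j : ℕ)) (hQ0 : Q (0, (0, 0)) ≠ 0)
    (v : Fin n → ℝ) (hv : fderiv ℝ R (0, 0) (0, v) = 0) : v = 0 := by
  have hsm : ∀ᶠ y in nhds (0:ℝ), |y| ≤ 1/2 := by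
    filter_upwards [Metric.closedBall_mem_nhds (0:ℝ) (by norm_num : (0:ℝ) < 1/2)] with y hy
    simpa using hy
  have hQd : Differentiable ℝ Q := hQ.differentiable (by simp)
  have hRd : Differentiable ℝ R := hR.differentiable (by simp)
  have hQc : Continuous (fun y : ℝ => Q (0, (y, 0))) := by
    have := hQ.continuous
    fun_prop
  have hQ'c : Continuous (fun y : ℝ => fderiv ℝ Q (0, (y, 0)) (0, (0, v))) := by
    have := hQ.continuous_fderiv (by simp)
    fun_prop
  have hne : ∀ᶠ y in nhds (0:ℝ), Q (0, (y, 0)) ≠ 0 :=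
    hQc.continuousAt.eventually_ne hQ0
  have key : ∀ y : ℝ, |y| ≤ 1/2 → 0 = fderiv ℝ Q (0, (y, 0)) (0, (0, v)) * y ^ n +
      Q (0, (y, 0)) * ∑ i, v i * y ^ (i : ℕ) := by
    intro y hy
    have hcq : HasDerivAt (fun t : ℝ => ((0:ℝ), (y, t • v))) (0, (0, v)) 0 := by
      refine (hasDerivAt_const _ _).prodMk ((hasDerivAt_const _ _).prodMk ?_)
      simpa using (hasDerivAt_id (0:ℝ)).smul_const v
    have hcr : HasDerivAt (fun t : ℝ => ((0:ℝ), t • v)) (0, v) 0 := by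
      refine (hasDerivAt_const _ _).prodMk ?_
      simpa using (hasDerivAt_id (0:ℝ)).smul_const v
    have d1 : HasDerivAt (fun t : ℝ => Q (0, (y, t • v))) (fderiv ℝ Q (0, (y, 0)) (0, (0, v))) 0 := by
      have e : ((0:ℝ), (y, (0:Fin n → ℝ))) = (0, (y, (0:ℝ) • v)) := by simp
      rw [e]
      exact (hQd _).hasFDerivAt.comp_hasDerivAt (0:ℝ) hcq
    have d2 : HasDerivAt (fun t : ℝ => R (0, t • v)) 0 0 := by
      rw [← hv]
      have e : ((0:ℝ), (0:Fin n → ℝ)) = (0, (0:ℝ) • v) := by simp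
      rw [e]
      exact (hRd _).hasFDerivAt.comp_hasDerivAt (0:ℝ) hcr
    have d3 : HasDerivAt (fun t : ℝ => y ^ n + ∑ i, (t • v) i * y ^ (i : ℕ))
        (∑ i, v i * y ^ (i : ℕ)) 0 := by
      have e : (fun t : ℝ => y ^ n + ∑ i, (t • v) i * y ^ (i : ℕ)) =
          fun t : ℝ => y ^ n + t * ∑ i, v i * y ^ (i : ℕ) := by
        funext t; simp [Finset.mul_sum, mul_assoc]
      rw [e]
      simpa using ((hasDerivAt_id (0:ℝ)).mul_const (∑ i, v i * y ^ (i : ℕ))).const_add (y ^ n)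
    have d4 : HasDerivAt (fun t : ℝ => ∑ j, R (0, t • v) j * y ^ (j : ℕ)) 0 0 := by
      have : HasDerivAt (fun t : ℝ => ∑ j, R (0, t • v) j * y ^ (j : ℕ))
          (∑ j : Fin n, (0 : Fin n → ℝ) j * y ^ (j : ℕ)) 0 :=
        HasDerivAt.fun_sum fun j _ => ((hasDerivAt_pi.1 d2) j).mul_const _
      simpa using this
    have d5 := (d1.mul d3).add d4
    have hev : ∀ᶠ t in nhds (0:ℝ), ∀ i, |(t • v) i| ≤ 1/2 := by
      rw [eventually_all]
      intro i
      have : Continuous fun t : ℝ => |(t • v) i| := by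
        simp only [Pi.smul_apply, smul_eq_mul]; fun_prop
      have h3 := this.continuousAt (x := 0)
      refine h3.eventually_le_const ?_
      simp
    have d6 : HasDerivAt (fun _ : ℝ => f (0, y)) _ 0 := d5.congr_of_eventuallyEq (by
      filter_upwards [hev] with t ht
      exact h 0 y (t • v) hy ht)
    have := (hasDerivAt_const (0:ℝ) (f (0, y))).unique d6
    simpa using this
  refine (mg_poly n v (fun y => - (fderiv ℝ Q (0, (y, 0)) (0, (0, v))) / Q (0, (y, 0))) _
    (((hQ'c.neg.continuousAt (x := 0)).div hQc.continuousAt hQ0).tendsto.mono_left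
      nhdsWithin_le_nhds) ?_).1
  apply nhdsWithin_le_nhds
  filter_upwards [hsm, hne] with y hy hy2
  have := key y hy
  field_simp
  linarith


lemma mg_implicit {n : ℕ} {R : ℝ × (Fin n → ℝ) → (Fin n → ℝ)} (hR : ContDiff ℝ ∞ R)
    (hR0 : R (0, 0) = 0)
    (hinj : ∀ v : Fin n → ℝ, fderiv ℝ R (0, 0) (0, v) = 0 → v = 0) :
    ∃ δ > 0, ∃ lam : ℝ → (Fin n → ℝ), lam 0 = 0 ∧
      ∀ x, |x| < δ → ContDiffAt ℝ ∞ lam x ∧ R (x, lam x) = 0 := by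
  set Φ : ℝ × (Fin n → ℝ) → ℝ × (Fin n → ℝ) := fun p => (p.1, R p) with hΦ
  have hΦc : ContDiff ℝ ∞ Φ := contDiff_fst.prodMk hR
  have hRd : Differentiable ℝ R := hR.differentiable (by simp)
  have hΦd : ∀ p, HasFDerivAt Φ (fderiv ℝ Φ p) p := fun p =>
    (hΦc.differentiable (by simp) p).hasFDerivAt
  have hfd : ∀ p, fderiv ℝ Φ p = (ContinuousLinearMap.fst ℝ ℝ (Fin n → ℝ)).prod (fderiv ℝ R p) :=
    fun p => (hasFDerivAt_fst.prodMk (hRd p).hasFDerivAt).fderiv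
  have hinj' : Function.Injective (fderiv ℝ Φ (0, 0)) := by
    rw [injective_iff_map_eq_zero]
    rintro ⟨a, v⟩ hav
    rw [hfd] at hav
    have h1 := congrArg Prod.fst hav
    have h2 := congrArg Prod.snd hav
    simp only [ContinuousLinearMap.prod_apply, ContinuousLinearMap.coe_fst', Prod.fst_zero,
      Prod.snd_zero] at h1 h2
    subst h1
    rw [hinj v h2]
    rfl
  set A : (ℝ × (Fin n → ℝ)) ≃L[ℝ] (ℝ × (Fin n → ℝ)) :=
    (LinearEquiv.ofInjectiveEndo (fderiv ℝ Φ (0, 0)).toLinearMap hinj').toContinuousLinearEquiv with hA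
  have hAeq : (A : (ℝ × (Fin n → ℝ)) →L[ℝ] (ℝ × (Fin n → ℝ))) = fderiv ℝ Φ (0, 0) := by
    ext p <;> rfl
  have hΦA : HasFDerivAt Φ (A : (ℝ × (Fin n → ℝ)) →L[ℝ] (ℝ × (Fin n → ℝ))) (0, 0) := by
    rw [hAeq]; exact hΦd _
  have hn : (∞ : WithTop ℕ∞) ≠ 0 := by simp
  set e := (hΦc.contDiffAt (x := (0,0))).toOpenPartialHomeomorph Φ hΦA hn with he
  have hecoe : (e : ℝ × (Fin n → ℝ) → ℝ × (Fin n → ℝ)) = Φ := rfl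
  have hs : ((0:ℝ), (0 : Fin n → ℝ)) ∈ e.source :=
    (hΦc.contDiffAt).mem_toOpenPartialHomeomorph_source hΦA hn
  have hΦ0 : Φ (0, 0) = (0, 0) := by simp [hΦ, hR0]
  have ht : ((0:ℝ), (0 : Fin n → ℝ)) ∈ e.target := by
    have := e.map_source hs
    rwa [hecoe, hΦ0] at this
  have hsymm0 : e.symm (0, 0) = (0, 0) := by
    have := e.left_inv hs
    rwa [hecoe, hΦ0] at this
  have hev1 : ∀ᶠ q in nhds ((0:ℝ), (0 : Fin n → ℝ)), q ∈ e.target := e.open_target.mem_nhds ht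
  have hev2 : ∀ᶠ q in nhds ((0:ℝ), (0 : Fin n → ℝ)), fderiv ℝ Φ (e.symm q) ∈
      range ((↑) : ((ℝ × (Fin n → ℝ)) ≃L[ℝ] (ℝ × (Fin n → ℝ))) →
        (ℝ × (Fin n → ℝ)) →L[ℝ] (ℝ × (Fin n → ℝ))) := by
    have c1 : ContinuousAt (fun q => fderiv ℝ Φ (e.symm q)) ((0:ℝ), (0 : Fin n → ℝ)) :=
      (hΦc.continuous_fderiv (by simp)).continuousAt.comp (e.continuousAt_symm ht)
    apply c1
    show _ ∈ nhds (fderiv ℝ Φ (e.symm (0, 0)))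
    rw [hsymm0, ← hAeq]
    exact ContinuousLinearEquiv.nhds A
  have hlin : ContDiff ℝ ∞ (fun x : ℝ => (x, (0 : Fin n → ℝ))) := contDiff_id.prodMk contDiff_const
  have hev : ∀ᶠ x in nhds (0:ℝ), (x, (0 : Fin n → ℝ)) ∈ e.target ∧
      fderiv ℝ Φ (e.symm (x, 0)) ∈
      range ((↑) : ((ℝ × (Fin n → ℝ)) ≃L[ℝ] (ℝ × (Fin n → ℝ))) →
        (ℝ × (Fin n → ℝ)) →L[ℝ] (ℝ × (Fin n → ℝ))) :=
    (hlin.continuous.tendsto (0:ℝ)).eventually (hev1.and hev2)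
  obtain ⟨δ, hδ, hball⟩ := Metric.eventually_nhds_iff.1 hev
  refine ⟨δ, hδ, fun x => (e.symm (x, 0)).2, by simp [hsymm0], ?_⟩
  intro x hx
  obtain ⟨hxt, B, hB⟩ := hball (y := x) (by simpa using hx)
  constructor
  · have : ContDiffAt ℝ ∞ e.symm (x, 0) := e.contDiffAt_symm hxt (f₀' := B)
      (by rw [hB]; exact hΦd _) hΦc.contDiffAt
    exact contDiffAt_snd.comp x (this.comp x hlin.contDiffAt)
  · have h1 := e.right_inv hxt
    rw [hecoe] at h1
    have h2 : (e.symm (x, 0)).1 = x := congrArg Prod.fst h1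
    have h3 : R (e.symm (x, 0)) = 0 := congrArg Prod.snd h1
    have h4 : ((x, (e.symm (x, 0)).2) : ℝ × (Fin n → ℝ)) = e.symm (x, 0) := Prod.ext h2.symm rfl
    show R (x, (e.symm (x, 0)).2) = 0
    rw [h4, h3]

lemma mg_cutoff (G : ℝ × ℝ → ℝ) (W : Set (ℝ × ℝ)) (hW : W ∈ nhds (0 : ℝ × ℝ))
    (hG : ContDiffOn ℝ ∞ G W) :
    ∃ f : ℝ × ℝ → ℝ, ContDiff ℝ ∞ f ∧ HasCompactSupport f ∧
      (∀ x t, 1 < |t| → f (x, t) = 0) ∧ ∀ᶠ p in nhds (0 : ℝ × ℝ), f p = G p := by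
  obtain ⟨r, hr, hrW⟩ := Metric.mem_nhds_iff.1 hW
  have hm : 0 < min r 1 := lt_min hr one_pos
  let ρ : ContDiffBump (0 : ℝ × ℝ) := ⟨min r 1 / 4, min r 1 / 2, by linarith, by linarith⟩
  have hrOut : ρ.rOut = min r 1 / 2 := rfl
  have hlr : ρ.rOut < r := by rw [hrOut]; linarith [min_le_left r 1]
  have hl1 : ρ.rOut ≤ 1 := by rw [hrOut]; linarith [min_le_right r 1]
  refine ⟨fun p => ρ p * G p, ?_, ?_, ?_, ?_⟩
  · rw [contDiff_iff_contDiffAt]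
    intro p
    by_cases hp : p ∈ Metric.ball (0 : ℝ × ℝ) r
    · exact ρ.contDiff.contDiffAt.mul
        (hG.contDiffAt (mem_of_superset (Metric.isOpen_ball.mem_nhds hp) hrW))
    · have : ∀ᶠ q in nhds p, ρ q * G q = 0 := by
        have hp2 : ρ.rOut < dist p 0 := by
          rw [Metric.mem_ball, not_lt] at hp; linarith
        have hc : Continuous fun q : ℝ × ℝ => dist q 0 := by fun_prop
        filter_upwards [hc.continuousAt.eventually_const_lt hp2] with q hq
        rw [ρ.zero_of_le_dist hq.le, zero_mul]
      exact contDiffAt_const.congr_of_eventuallyEq this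
  · exact ρ.hasCompactSupport.mul_right
  · intro x t ht
    have : ρ.rOut ≤ dist (x, t) (0 : ℝ × ℝ) := by
      rw [dist_zero_right, Prod.norm_def]
      exact le_trans (hl1.trans ht.le) (le_max_right _ _)
    simp only [ρ.zero_of_le_dist this, zero_mul]
  · filter_upwards [ρ.eventuallyEq_one] with p hp
    rw [hp]; simp

theorem statement5 (F : ℝ → ℝ → ℝ) (W : Set (ℝ × ℝ)) (hW : W ∈ nhds (0 : ℝ × ℝ))
    (hF : ContDiffOn ℝ (⊤ : ℕ∞) (fun p : ℝ × ℝ => F p.1 p.2) W)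
    (n : ℕ) (c : ℝ) (hc : c ≠ 0)
    (hasymp : (fun y : ℝ => F 0 y - c * y ^ n) =o[nhds 0] fun y : ℝ => y ^ n) :
    ∃ ε : ℝ, 0 < ε ∧
      ∃ (U : ℝ → ℝ → ℝ) (cf : Fin n → ℝ → ℝ),
        ContDiffOn ℝ (⊤ : ℕ∞) (fun p : ℝ × ℝ => U p.1 p.2) (Metric.ball (0 : ℝ × ℝ) ε) ∧
        U 0 0 ≠ 0 ∧
        (∀ i : Fin n, ContDiffOn ℝ (⊤ : ℕ∞) (cf i) (Ioo (-ε) ε) ∧ cf i 0 = 0) ∧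
        ∀ p : ℝ × ℝ, p ∈ Metric.ball (0 : ℝ × ℝ) ε →
          F p.1 p.2 = U p.1 p.2 * (p.2 ^ n + ∑ i : Fin n, cf i p.1 * p.2 ^ (i : ℕ)) := by
  obtain ⟨f, hf, hsupp, h0, hfF⟩ := mg_cutoff (fun p : ℝ × ℝ => F p.1 p.2) W hW hF
  obtain ⟨Q, R, hQ, hR, h⟩ := mg_division_real n f hf hsupp h0
  have hyF : ∀ᶠ y in nhds (0:ℝ), f (0, y) = F 0 y := by
    have hct : Tendsto (fun y : ℝ => ((0:ℝ), y)) (nhds 0) (nhds (0 : ℝ × ℝ)) :=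
      (Continuous.prodMk_right (0:ℝ)).tendsto 0
    exact hct.eventually hfF
  have has2 : (fun y : ℝ => f (0, y) - c * y ^ n) =o[nhds 0] fun y : ℝ => y ^ n := by
    refine hasymp.congr' ?_ EventuallyEq.rfl
    filter_upwards [hyF] with y hy
    rw [hy]
  obtain ⟨hR0, hQ0⟩ := mg_prep_point hQ h has2
  obtain ⟨δ, hδ, lam, hlam0, hlam⟩ := mg_implicit hR hR0
    (mg_prep_inj hQ hR h (by rw [hQ0]; exact hc))
  have hlc : ContinuousAt lam 0 := (hlam 0 (by simpa using hδ)).1.continuousAt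
  have hls : ∀ᶠ x in nhds (0:ℝ), ∀ i, |lam x i| ≤ 1 / 2 := by
    rw [eventually_all]
    intro i
    have h3 : ContinuousAt (fun x => |lam x i|) 0 := ((continuousAt_pi.1 hlc) i).abs
    refine h3.eventually_le_const ?_
    simp [hlam0]
  obtain ⟨ε1, hε1, hb1⟩ := Metric.eventually_nhds_iff.1 hls
  obtain ⟨ε2, hε2, hb2⟩ := Metric.eventually_nhds_iff.1 hfF
  obtain ⟨ε, hε, hεm⟩ : ∃ ε : ℝ, 0 < ε ∧ ε ≤ δ ∧ ε ≤ ε1 ∧ ε ≤ ε2 ∧ ε ≤ 1 / 2 := by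
    refine ⟨min (min δ ε1) (min ε2 (1/2)), by positivity, ?_, ?_, ?_, ?_⟩
    · exact (min_le_left _ _).trans (min_le_left _ _)
    · exact (min_le_left _ _).trans (min_le_right _ _)
    · exact (min_le_right _ _).trans (min_le_left _ _)
    · exact (min_le_right _ _).trans (min_le_right _ _)
  obtain ⟨hm1, hm2, hm3, hm4⟩ := hεm
  have hcoord : ∀ p : ℝ × ℝ, p ∈ Metric.ball (0 : ℝ × ℝ) ε → |p.1| < ε ∧ |p.2| < ε := by
    intro p hp
    rw [mem_ball_zero_iff, Prod.norm_def, max_lt_iff] at hp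
    exact hp
  refine ⟨ε, hε, fun x y => Q (x, (y, lam x)), fun i x => lam x i, ?_, ?_, ?_, ?_⟩
  · intro p hp
    apply ContDiffAt.contDiffWithinAt
    have hl := (hlam p.1 ((hcoord p hp).1.trans_le hm1)).1
    have hl2 : ContDiffAt ℝ ∞ (fun q : ℝ × ℝ => lam q.1) p := hl.comp p contDiffAt_fst
    exact hQ.contDiffAt.comp p (contDiffAt_fst.prodMk (contDiffAt_snd.prodMk hl2))
  · simp only [hlam0, hQ0]; exact hc
  · intro i
    refine ⟨?_, by simp [hlam0]⟩
    intro x hx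
    apply ContDiffAt.contDiffWithinAt
    have hl := (hlam x ((abs_lt.2 hx).trans_le hm1)).1
    exact contDiffAt_pi.1 hl i
  · intro p hp
    obtain ⟨h1, h2⟩ := hcoord p hp
    have e1 := hb2 (lt_of_lt_of_le (Metric.mem_ball.1 hp) hm3)
    have e2 := h p.1 p.2 (lam p.1) (h2.le.trans hm4)
      (hb1 (by rw [dist_zero_right]; exact h1.trans_le hm2))
    rw [(hlam p.1 (h1.trans_le hm1)).2] at e2
    simp only [Pi.zero_apply, zero_mul, Finset.sum_const_zero, add_zero] at e2
    rw [← e1]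
    exact e2
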